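/- Let α ≥ 0 be a real number. For all integers n ≥ Ñ(α), one has L_1(n,α) < u_α(n+1) < U_1(n,α), where u_α(n) = r_α(n−1)·r_α(n+1)/r_α(n)², U_1(n,α) = 1 + 3π/(4n^{5/2}) + (3 + 3α − 2·log 8 − 2(1+α)·log n)/n³ − 15(2 + π²)/(8π·n^{7/2}) + (1/(π²·n⁴))·(−3 − 11π² − 11απ² + 6π²·log 8 + (6 + 6α)π²·log n) + 35(21π⁴ + 72π² − 16)/(192π³·n^{9/2}) + (1/n⁵)·(12 + (2^{12} + 26)π² − 12π²·log 8 + 32απ² + π²·2^{31+18α} + (2 + 17α)π²·log n), and L_1(n,α) = 1 + 3π/(4n^{5/2}) + (3 + 3α − 2·log 8 − 2(1+α)·log n)/n³ − 15(2 + π²)/(8π·n^{7/2}) + (1/(π²·n⁴))·(−3 − 11π² − 11απ² + 6π²·log 8 + (6 + 6α)π²·log n) + 35(21π⁴ + 72π² − 16)/(192π³·n^{9/2}) − (1/n⁵)·(256 + 105·(9π²·(4 + π²) − 16)/(128π³) + 8·(3α + 2^{7α+13} + 13)·log n). -/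

import Mathlib

open Real

/-- The overpartition function. -/
noncomputable def pbar (n : ℕ) : ℕ :=
  ∑ k ∈ Finset.range (n + 1),
    (Nat.Partition.distincts k).card * Fintype.card (Nat.Partition (n - k))

/-- `r_α(n) = (p̄(n)/n^α)^(1/n)`. -/
noncomputable def rseq (α : ℝ) (n : ℕ) : ℝ :=
  ((pbar n : ℝ) / (n : ℝ) ^ α) ^ ((n : ℝ)⁻¹)

/-- `u_α(n) = r_α(n−1) r_α(n+1) / r_α(n)²`. -/
noncomputable def useq (α : ℝ) (n : ℕ) : ℝ :=
  rseq α (n - 1) * rseq α (n + 1) / (rseq α n) ^ 2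

noncomputable def Nt1 (α : ℝ) : ℝ :=
  max ((⌈Real.sqrt (2 * α)⌉ : ℤ) : ℝ)
    (max ((⌈(3 * α) ^ ((1 : ℝ) / 3)⌉ : ℤ) : ℝ)
      (max ((⌈(11 * α / 3) ^ ((1 : ℝ) / 4)⌉ : ℤ) : ℝ) ((⌈(10 * α) ^ ((1 : ℝ) / 5)⌉ : ℤ) : ℝ)))

noncomputable def Nt2 (α : ℝ) : ℝ :=
  max (2 : ℝ) (max ((⌈Real.sqrt (2 * α)⌉ : ℤ) : ℝ)
    (max ((⌈(3 * α) ^ ((1 : ℝ) / 3)⌉ : ℤ) : ℝ)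
      (max ((⌈(11 * α / 3) ^ ((1 : ℝ) / 4)⌉ : ℤ) : ℝ) ((⌈(12 * α) ^ ((1 : ℝ) / 5)⌉ : ℤ) : ℝ))))

noncomputable def Nt3 (α : ℝ) : ℝ :=
  max (5505 : ℝ) (max ((⌈(4 * α / (α ^ 2 + 1)) ^ ((4 : ℝ) / 3)⌉ : ℤ) : ℝ)
    ((⌈(4 * α) ^ ((4 : ℝ) / 11)⌉ : ℤ) : ℝ))

noncomputable def Ntil (α : ℝ) : ℝ := max (Nt1 α) (max (Nt2 α) (Nt3 α))
noncomputable def U1bound (n : ℕ) (α : ℝ) : ℝ :=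
  1 + 3 * π / (4 * (n : ℝ) ^ ((5 : ℝ) / 2))
    + (3 + 3 * α - 2 * Real.log 8 - 2 * (1 + α) * Real.log n) / (n : ℝ) ^ 3
    - 15 * (2 + π ^ 2) / (8 * π * (n : ℝ) ^ ((7 : ℝ) / 2))
    + (1 / (π ^ 2 * (n : ℝ) ^ 4)) *
        (-3 - 11 * π ^ 2 - 11 * α * π ^ 2 + 6 * π ^ 2 * Real.log 8
          + (6 + 6 * α) * π ^ 2 * Real.log n)
    + 35 * (21 * π ^ 4 + 72 * π ^ 2 - 16) / (192 * π ^ 3 * (n : ℝ) ^ ((9 : ℝ) / 2))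
    + (1 / (n : ℝ) ^ 5) *
        (12 + (2 ^ 12 + 26) * π ^ 2 - 12 * π ^ 2 * Real.log 8 + 32 * α * π ^ 2
          + π ^ 2 * (2 : ℝ) ^ (31 + 18 * α) + (2 + 17 * α) * π ^ 2 * Real.log n)

noncomputable def L1bound (n : ℕ) (α : ℝ) : ℝ :=
  1 + 3 * π / (4 * (n : ℝ) ^ ((5 : ℝ) / 2))
    + (3 + 3 * α - 2 * Real.log 8 - 2 * (1 + α) * Real.log n) / (n : ℝ) ^ 3
    - 15 * (2 + π ^ 2) / (8 * π * (n : ℝ) ^ ((7 : ℝ) / 2))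
    + (1 / (π ^ 2 * (n : ℝ) ^ 4)) *
        (-3 - 11 * π ^ 2 - 11 * α * π ^ 2 + 6 * π ^ 2 * Real.log 8
          + (6 + 6 * α) * π ^ 2 * Real.log n)
    + 35 * (21 * π ^ 4 + 72 * π ^ 2 - 16) / (192 * π ^ 3 * (n : ℝ) ^ ((9 : ℝ) / 2))
    - (1 / (n : ℝ) ^ 5) *
        (256 + 105 * (9 * π ^ 2 * (4 + π ^ 2) - 16) / (128 * π ^ 3)
          + 8 * (3 * α + (2 : ℝ) ^ (7 * α + 13) + 13) * Real.log n)

section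

open Filter Topology MeasureTheory

/-- The finite product `∏_{k=1}^{N} (1 + q^k) / (1 - q^k)`. -/
noncomputable def overProd {K : Type*} [Field K] (N : ℕ) (q : K) : K :=
  ∏ k ∈ Finset.range N, (1 + q ^ (k + 1)) / (1 - q ^ (k + 1))

/-- The partial sum `1 + 2 ∑_{s=1}^{N} (-1)^s q^{s²}` of the theta series. -/
def thetaPartial {K : Type*} [Field K] (N : ℕ) (q : K) : K :=
  1 + 2 * ∑ s ∈ Finset.range N, (-1) ^ (s + 1) * q ^ ((s + 1) ^ 2)

theorem overProd_succ {K : Type*} [Field K] (N : ℕ) (q : K) :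
    overProd (N + 1) q = overProd N q * ((1 + q ^ (N + 1)) / (1 - q ^ (N + 1))) :=
  Finset.prod_range_succ _ _

section Shanks

variable {K : Type*} [Field K] {q : K}

theorem sum_shanks_telescope (h1 : ∀ k : ℕ, 1 - q ^ (k + 1) ≠ 0)
    (h2 : ∀ k : ℕ, 1 + q ^ (k + 1) ≠ 0) (n m : ℕ) :
    ∑ s ∈ Finset.range m, 2 * (-1) ^ (s + 1) * overProd (s + 1) q / (1 + q ^ (s + 1)) *
        ((1 - q ^ n) * q ^ ((s + 1) * (n + 1)) - (1 + q ^ n) * q ^ ((s + 1) * n)) =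
      2 * q ^ n - 2 * (-1) ^ m * overProd m q * q ^ (n * (m + 1)) := by
  induction m with
  | zero => simp [overProd]
  | succ m ih =>
    rw [Finset.sum_range_succ, ih, overProd_succ]
    have := h1 m
    have := h2 m
    field_simp
    ring

/-- Shanks' finite form of Gauss' identity for `∑ (-1)^n q^{n²}`. -/
theorem thetaPartial_mul_overProd (h1 : ∀ k : ℕ, 1 - q ^ (k + 1) ≠ 0)
    (h2 : ∀ k : ℕ, 1 + q ^ (k + 1) ≠ 0) (n : ℕ) :
    thetaPartial n q * overProd n q =
      1 + ∑ s ∈ Finset.range n, 2 * (-1) ^ (s + 1) * overProd (s + 1) q / (1 + q ^ (s + 1)) *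
        q ^ ((s + 1) * (n + 1)) := by
  induction n with
  | zero => simp [overProd, thetaPartial]
  | succ n ih =>
    have h := sum_shanks_telescope h1 h2 (n + 1) n
    simp only [mul_sub, Finset.sum_sub_distrib] at h
    have e1 : ∀ x y z : K, x * (y * z) = y * (x * z) := fun x y z => by ring
    simp only [e1 _ (1 - q ^ (n + 1)), e1 _ (1 + q ^ (n + 1)), ← Finset.mul_sum] at h
    have e2 : thetaPartial (n + 1) q
        = thetaPartial n q + 2 * ((-1) ^ (n + 1) * q ^ ((n + 1) ^ 2)) := by
      simp only [thetaPartial, Finset.sum_range_succ]; ring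
    rw [Finset.sum_range_succ]
    have e3 : thetaPartial (n + 1) q * overProd (n + 1) q =
        (thetaPartial n q * overProd n q) * ((1 + q ^ (n + 1)) / (1 - q ^ (n + 1))) +
        2 * ((-1) ^ (n + 1) * q ^ ((n + 1) ^ 2)) * overProd (n + 1) q := by
      rw [e2, overProd_succ]; ring
    rw [e3, ih]
    have a1 := h1 n
    have a2 := h2 n
    apply mul_left_cancel₀ a1
    set T := ∑ s ∈ Finset.range n, 2 * (-1) ^ (s + 1) * overProd (s + 1) q / (1 + q ^ (s + 1)) *
        q ^ ((s + 1) * (n + 1))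
    set T' := ∑ s ∈ Finset.range n, 2 * (-1) ^ (s + 1) * overProd (s + 1) q / (1 + q ^ (s + 1)) *
        q ^ ((s + 1) * (n + 1 + 1))
    rw [mul_add (1 - q ^ (n + 1)) 1, mul_add (1 - q ^ (n + 1)) T', eq_add_of_sub_eq h, overProd_succ]
    field_simp
    ring

end Shanks

open PowerSeries in
/-- The real power series `f` converges absolutely at `q`, with sum `v`. -/
def EvalsTo (f : PowerSeries ℝ) (q v : ℂ) : Prop :=
  Summable (fun n => ‖((coeff n f : ℝ) : ℂ) * q ^ n‖) ∧ ∑' n, ((coeff n f : ℝ) : ℂ) * q ^ n = v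

namespace EvalsTo

open PowerSeries

variable {f g : PowerSeries ℝ} {q v w : ℂ}

theorem mul (hf : EvalsTo f q v) (hg : EvalsTo g q w) : EvalsTo (f * g) q (v * w) := by
  set a : ℕ → ℂ := fun n => ((coeff n f : ℝ) : ℂ) * q ^ n with ha
  set b : ℕ → ℂ := fun n => ((coeff n g : ℝ) : ℂ) * q ^ n with hb
  have key : ∀ n, ((coeff n (f * g) : ℝ) : ℂ) * q ^ n =
      ∑ kl ∈ Finset.HasAntidiagonal.antidiagonal n, a kl.1 * b kl.2 := by
    intro n
    rw [coeff_mul, Complex.ofReal_sum, Finset.sum_mul]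
    refine Finset.sum_congr rfl fun kl hkl => ?_
    have e : kl.1 + kl.2 = n := Finset.HasAntidiagonal.mem_antidiagonal.mp hkl
    rw [Complex.ofReal_mul, ← e, pow_add]
    exact mul_mul_mul_comm _ _ _ _
  have hfa : Summable fun n => ‖a n‖ := hf.1
  have hgb : Summable fun n => ‖b n‖ := hg.1
  constructor
  · simp_rw [key]
    exact summable_norm_sum_mul_antidiagonal_of_summable_norm hfa hgb
  · simp_rw [key]
    rw [← tsum_mul_tsum_eq_tsum_sum_antidiagonal_of_summable_norm hfa hgb]
    exact congrArg₂ (· * ·) hf.2 hg.2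

theorem one : EvalsTo 1 q 1 := by
  have h : ∀ n, n ≠ 0 → ((coeff n (1 : PowerSeries ℝ) : ℝ) : ℂ) * q ^ n = 0 := by
    intro n hn; simp [coeff_one, hn]
  constructor
  · refine summable_of_ne_finset_zero (s := {0}) fun n hn => ?_
    rw [h n (by simpa using hn), norm_zero]
  · rw [tsum_eq_single 0 h]; simp

theorem X_pow (k : ℕ) : EvalsTo (X ^ k) q (q ^ k) := by
  have h : ∀ n, n ≠ k → ((coeff n (X ^ k : PowerSeries ℝ) : ℝ) : ℂ) * q ^ n = 0 := by
    intro n hn; simp [coeff_X_pow, hn]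
  constructor
  · refine summable_of_ne_finset_zero (s := {k}) fun n hn => ?_
    rw [h n (by simpa using hn), norm_zero]
  · rw [tsum_eq_single k h]; simp [coeff_X_pow]

theorem add (hf : EvalsTo f q v) (hg : EvalsTo g q w) : EvalsTo (f + g) q (v + w) := by
  have key : ∀ n, ((coeff n (f + g) : ℝ) : ℂ) * q ^ n =
      ((coeff n f : ℝ) : ℂ) * q ^ n + ((coeff n g : ℝ) : ℂ) * q ^ n := by
    intro n; simp [add_mul]
  constructor
  · simp_rw [key]
    exact Summable.of_nonneg_of_le (fun _ => norm_nonneg _) (fun n => norm_add_le _ _)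
      (hf.1.add hg.1)
  · simp_rw [key]
    rw [hf.1.of_norm.tsum_add hg.1.of_norm, hf.2, hg.2]

theorem neg (hf : EvalsTo f q v) : EvalsTo (-f) q (-v) := by
  constructor
  · simpa using hf.1
  · simp only [map_neg, Complex.ofReal_neg, neg_mul, tsum_neg, hf.2]

theorem unique (hf : EvalsTo f q v) (hg : EvalsTo f q w) : v = w := hf.2.symm.trans hg.2

theorem of_coeff_le_one (hq : ‖q‖ < 1) (h : ∀ n, |coeff n f| ≤ 1) : ∃ v, EvalsTo f q v := by
  refine ⟨_, ?_, rfl⟩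
  refine Summable.of_nonneg_of_le (fun _ => norm_nonneg _) (fun n => ?_)
    (summable_geometric_of_lt_one (norm_nonneg q) hq)
  rw [norm_mul, norm_pow, Complex.norm_real, Real.norm_eq_abs]
  exact mul_le_of_le_one_left (by positivity) (h n)

end EvalsTo

/-- The geometric series `∑ X^{kj}`. -/
noncomputable def geomSeries (k : ℕ) : PowerSeries ℝ :=
  PowerSeries.mk fun n => if k ∣ n then 1 else 0

theorem one_sub_X_pow_mul_geomSeries {k : ℕ} (hk : k ≠ 0) :
    (1 - PowerSeries.X ^ k) * geomSeries k = 1 := by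
  ext n
  rw [sub_mul, one_mul, map_sub, PowerSeries.coeff_X_pow_mul', geomSeries, PowerSeries.coeff_mk,
    PowerSeries.coeff_one]
  by_cases h : k ≤ n
  · have : n ≠ 0 := by omega
    have h3 : k ∣ n - k ↔ k ∣ n := Nat.dvd_sub_iff_left h dvd_rfl
    simp only [h, if_true, PowerSeries.coeff_mk, h3, this, if_false, sub_self]
  · by_cases h2 : n = 0
    · simp [h2, hk]
    · have : ¬ k ∣ n := fun hd => h (Nat.le_of_dvd (Nat.pos_of_ne_zero h2) hd)
      simp [h, h2, this]

theorem one_sub_pow_ne_zero {q : ℂ} (hq : ‖q‖ < 1) (k : ℕ) : 1 - q ^ (k + 1) ≠ 0 := by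
  intro h
  have : ‖q ^ (k + 1)‖ = 1 := by rw [← sub_eq_zero.mp h]; simp
  rw [norm_pow] at this
  exact (pow_lt_one₀ (norm_nonneg q) hq (Nat.succ_ne_zero k)).ne this

theorem one_add_pow_ne_zero {q : ℂ} (hq : ‖q‖ < 1) (k : ℕ) : 1 + q ^ (k + 1) ≠ 0 := by
  intro h
  have : ‖q ^ (k + 1)‖ = 1 := by rw [eq_neg_of_add_eq_zero_right h]; simp
  rw [norm_pow] at this
  exact (pow_lt_one₀ (norm_nonneg q) hq (Nat.succ_ne_zero k)).ne this

theorem EvalsTo.geomSeries {q : ℂ} (hq : ‖q‖ < 1) (k : ℕ) :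
    EvalsTo (geomSeries (k + 1)) q (1 - q ^ (k + 1))⁻¹ := by
  obtain ⟨v, hv⟩ := EvalsTo.of_coeff_le_one (f := _root_.geomSeries (k + 1)) hq (fun n => by
    rw [_root_.geomSeries, PowerSeries.coeff_mk]; split_ifs <;> simp)
  have h1 : EvalsTo (1 - PowerSeries.X ^ (k + 1)) q (1 - q ^ (k + 1)) := by
    rw [sub_eq_add_neg, sub_eq_add_neg]
    exact EvalsTo.one.add (EvalsTo.X_pow (k + 1)).neg
  have h2 := h1.mul hv
  rw [one_sub_X_pow_mul_geomSeries (Nat.succ_ne_zero k)] at h2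
  have h3 := h2.unique EvalsTo.one
  rwa [← eq_inv_of_mul_eq_one_right h3]

/-- The finite products `∏_{k=1}^{N} (1 + X^k) / (1 - X^k)` as power series. -/
noncomputable def overSeries (N : ℕ) : PowerSeries ℝ :=
  ∏ k ∈ Finset.range N, (1 + PowerSeries.X ^ (k + 1)) * geomSeries (k + 1)

theorem evalsTo_overSeries {q : ℂ} (hq : ‖q‖ < 1) (N : ℕ) :
    EvalsTo (overSeries N) q (overProd N q) := by
  induction N with
  | zero => simpa [overSeries, overProd] using EvalsTo.one
  | succ N ih =>
    rw [overSeries, Finset.prod_range_succ, overProd_succ, div_eq_mul_inv]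
    exact ih.mul ((EvalsTo.one.add (EvalsTo.X_pow (N + 1))).mul (EvalsTo.geomSeries hq N))

theorem coeff_mul_nonneg {f g : PowerSeries ℝ} (hf : ∀ n, 0 ≤ PowerSeries.coeff n f)
    (hg : ∀ n, 0 ≤ PowerSeries.coeff n g) (n : ℕ) : 0 ≤ PowerSeries.coeff n (f * g) := by
  rw [PowerSeries.coeff_mul]
  exact Finset.sum_nonneg fun p _ => mul_nonneg (hf _) (hg _)

theorem coeff_geomSeries_nonneg (k n : ℕ) : 0 ≤ PowerSeries.coeff n (geomSeries k) := by
  rw [geomSeries, PowerSeries.coeff_mk]; split_ifs <;> simp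

theorem coeff_one_add_X_pow_nonneg (k n : ℕ) :
    0 ≤ PowerSeries.coeff n (1 + PowerSeries.X ^ k : PowerSeries ℝ) := by
  rw [map_add, PowerSeries.coeff_one, PowerSeries.coeff_X_pow]
  positivity

theorem coeff_overSeries_nonneg (N n : ℕ) : 0 ≤ PowerSeries.coeff n (overSeries N) := by
  induction N generalizing n with
  | zero => simp only [overSeries, Finset.range_zero, Finset.prod_empty, PowerSeries.coeff_one]
            positivity
  | succ N ih =>
    rw [overSeries, Finset.prod_range_succ]
    exact coeff_mul_nonneg ih (coeff_mul_nonneg (coeff_one_add_X_pow_nonneg _)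
      (coeff_geomSeries_nonneg _)) n

theorem coeff_overSeries_mono (n : ℕ) :
    Monotone fun N => PowerSeries.coeff n (overSeries N) := by
  refine monotone_nat_of_le_succ fun N => ?_
  have h0 : ∀ n, 0 ≤ PowerSeries.coeff n
      ((1 + PowerSeries.X ^ (N + 1) : PowerSeries ℝ) * geomSeries (N + 1)) :=
    coeff_mul_nonneg (coeff_one_add_X_pow_nonneg _) (coeff_geomSeries_nonneg _)
  have h1 : PowerSeries.coeff 0
      ((1 + PowerSeries.X ^ (N + 1) : PowerSeries ℝ) * geomSeries (N + 1)) = 1 := by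
    simp [PowerSeries.coeff_mul, geomSeries]
  rw [overSeries, overSeries, Finset.prod_range_succ, ← overSeries, PowerSeries.coeff_mul n]
  refine le_trans (le_of_eq ?_) (Finset.single_le_sum (f := fun p : ℕ × ℕ =>
    PowerSeries.coeff p.1 (overSeries N) * PowerSeries.coeff p.2
      ((1 + PowerSeries.X ^ (N + 1) : PowerSeries ℝ) * geomSeries (N + 1)))
    (fun p _ => mul_nonneg (coeff_overSeries_nonneg N _) (h0 _))
    (Finset.HasAntidiagonal.mem_antidiagonal.mpr (show (n, 0).1 + (n, 0).2 = n from add_zero n)))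
  simp only [h1, mul_one]

open scoped PowerSeries.WithPiTopology in
theorem geomSeries_eq_tsum {k : ℕ} (hk : k ≠ 0) :
    (∑' j : ℕ, (PowerSeries.X : PowerSeries ℝ) ^ (k * j)) = geomSeries k := by
  have h := PowerSeries.WithPiTopology.one_sub_mul_tsum_pow_of_constantCoeff_eq_zero
    (f := (PowerSeries.X : PowerSeries ℝ) ^ k) (by simp [hk])
  have h2 := one_sub_X_pow_mul_geomSeries hk
  have hne : (1 - PowerSeries.X ^ k : PowerSeries ℝ) ≠ 0 := fun h0 => by simp [h0] at h2
  simp_rw [pow_mul]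
  exact mul_left_cancel₀ hne (h.trans h2.symm)

open scoped PowerSeries.WithPiTopology in
theorem hasProd_pbar : HasProd
    (fun k : ℕ => (1 + PowerSeries.X ^ (k + 1) : PowerSeries ℝ) * geomSeries (k + 1))
    (PowerSeries.mk fun n => (pbar n : ℝ)) := by
  have h1 := Nat.Partition.hasProd_powerSeriesMk_card_countRestricted ℝ (m := 2) (by norm_num)
  have h2 := Nat.Partition.hasProd_powerSeriesMk_card_restricted ℝ (fun _ => True)
  have h := h1.mul h2
  have e1 : (fun k : ℕ => (1 + PowerSeries.X ^ (k + 1) : PowerSeries ℝ) * geomSeries (k + 1)) =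
      fun b => (∑ j ∈ Finset.range 2, PowerSeries.X ^ ((b + 1) * j)) *
        if True then ∑' (j : ℕ), PowerSeries.X ^ ((b + 1) * j) else 1 := by
    ext1 k
    simp [Finset.sum_range_succ, geomSeries_eq_tsum]
  have e2 : (PowerSeries.mk fun n => (pbar n : ℝ)) =
      (PowerSeries.mk fun n => ((Nat.Partition.countRestricted n 2).card : ℝ)) *
      PowerSeries.mk fun n => ((Nat.Partition.restricted n fun x => True).card : ℝ) := by
    ext n
    rw [PowerSeries.coeff_mk, PowerSeries.coeff_mul,
      Finset.Nat.sum_antidiagonal_eq_sum_range_succ_mk, pbar]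
    push_cast
    refine Finset.sum_congr rfl fun k _ => ?_
    simp [Nat.Partition.countRestricted_two, Nat.Partition.restricted]
  rw [e1, e2]
  exact h

open scoped PowerSeries.WithPiTopology in
theorem tendsto_coeff_overSeries (n : ℕ) :
    Filter.Tendsto (fun N => PowerSeries.coeff n (overSeries N)) Filter.atTop
      (nhds (pbar n : ℝ)) := by
  have h := hasProd_pbar.tendsto_prod_nat
  have h2 := ((PowerSeries.WithPiTopology.continuous_coeff ℝ n).tendsto _).comp h
  rw [PowerSeries.coeff_mk] at h2
  exact h2

theorem overProd_le {r : ℝ} (h0 : 0 ≤ r) (h1 : r < 1) (N : ℕ) :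
    overProd N r ≤ exp (2 / (1 - r) ^ 2) := by
  have hr : 0 < 1 - r := by linarith
  have hk : ∀ k : ℕ, (1 + r ^ (k + 1)) / (1 - r ^ (k + 1)) ≤ exp (2 / (1 - r) * r ^ k) := by
    intro k
    have hp : r ^ (k + 1) ≤ r := by
      simpa using pow_le_pow_of_le_one h0 h1.le (Nat.succ_le_succ (Nat.zero_le k))
    have hp0 : 0 ≤ r ^ (k + 1) := by positivity
    have hp2 : r ^ (k + 1) ≤ r ^ k := pow_le_pow_of_le_one h0 h1.le (Nat.le_succ k)
    have h3 : (1 + r ^ (k + 1)) / (1 - r ^ (k + 1)) = 1 + 2 * r ^ (k + 1) / (1 - r ^ (k + 1)) := by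
      have : 1 - r ^ (k + 1) ≠ 0 := by linarith
      field_simp; ring
    have h4 : 2 * r ^ (k + 1) / (1 - r ^ (k + 1)) ≤ 2 / (1 - r) * r ^ k := by
      rw [div_mul_eq_mul_div]
      gcongr
    rw [h3]
    linarith [add_one_le_exp (2 / (1 - r) * r ^ k)]
  calc overProd N r ≤ ∏ k ∈ Finset.range N, exp (2 / (1 - r) * r ^ k) := by
        refine Finset.prod_le_prod (fun k _ => ?_) fun k _ => hk k
        have : r ^ (k + 1) ≤ 1 := pow_le_one₀ h0 h1.le
        have : 0 ≤ r ^ (k + 1) := by positivity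
        exact div_nonneg (by linarith) (by linarith)
    _ = exp (2 / (1 - r) * ∑ k ∈ Finset.range N, r ^ k) := by
        rw [← exp_sum, Finset.mul_sum]
    _ ≤ exp (2 / (1 - r) ^ 2) := by
        apply exp_le_exp.mpr
        have := (summable_geometric_of_lt_one h0 h1).sum_le_tsum (Finset.range N)
          (fun k _ => by positivity)
        rw [tsum_geometric_of_lt_one h0 h1] at this
        calc 2 / (1 - r) * ∑ k ∈ Finset.range N, r ^ k ≤ 2 / (1 - r) * (1 - r)⁻¹ := by gcongr
          _ = 2 / (1 - r) ^ 2 := by field_simp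

theorem overProd_nonneg {r : ℝ} (h0 : 0 ≤ r) (h1 : r < 1) (N : ℕ) : 0 ≤ overProd N r := by
  refine Finset.prod_nonneg fun k _ => ?_
  have : r ^ (k + 1) ≤ 1 := pow_le_one₀ h0 h1.le
  have : 0 ≤ r ^ (k + 1) := by positivity
  exact div_nonneg (by linarith) (by linarith)

theorem ofReal_overProd (N : ℕ) (r : ℝ) : ((overProd N r : ℝ) : ℂ) = overProd N (r : ℂ) := by
  simp [overProd]

theorem norm_overProd_le {q : ℂ} (hq : ‖q‖ < 1) (N : ℕ) : ‖overProd N q‖ ≤ overProd N ‖q‖ := by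
  rw [overProd, overProd, norm_prod]
  refine Finset.prod_le_prod (fun _ _ => norm_nonneg _) fun k _ => ?_
  have h1 : ‖q‖ ^ (k + 1) < 1 := pow_lt_one₀ (norm_nonneg q) hq (Nat.succ_ne_zero k)
  rw [norm_div]
  gcongr
  · simpa using norm_add_le (1 : ℂ) (q ^ (k + 1))
  · have := norm_sub_norm_le (1 : ℂ) (q ^ (k + 1))
    rwa [norm_one, norm_pow] at this

theorem coeff_overSeries_le (N n : ℕ) : PowerSeries.coeff n (overSeries N) ≤ pbar n :=
  (coeff_overSeries_mono n).ge_of_tendsto (tendsto_coeff_overSeries n) N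

theorem hasSum_overSeries_real {r : ℝ} (h0 : 0 ≤ r) (h1 : r < 1) (N : ℕ) :
    HasSum (fun n => PowerSeries.coeff n (overSeries N) * r ^ n) (overProd N r) := by
  have h := evalsTo_overSeries (q := (r : ℂ)) (by simpa [abs_of_nonneg h0] using h1) N
  have h2 := h.1.of_norm.hasSum
  rw [h.2, ← ofReal_overProd] at h2
  exact_mod_cast h2

theorem summable_pbar {r : ℝ} (h0 : 0 ≤ r) (h1 : r < 1) :
    Summable fun n => (pbar n : ℝ) * r ^ n := by
  refine summable_of_sum_range_le (c := exp (2 / (1 - r) ^ 2)) (fun n => by positivity) fun M => ?_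
  have ht : Tendsto (fun N => ∑ n ∈ Finset.range M, PowerSeries.coeff n (overSeries N) * r ^ n) atTop
      (𝓝 (∑ n ∈ Finset.range M, (pbar n : ℝ) * r ^ n)) :=
    tendsto_finsetSum _ fun n _ => (tendsto_coeff_overSeries n).mul_const _
  refine le_of_tendsto' ht fun N => ?_
  have hs := hasSum_overSeries_real h0 h1 N
  refine le_trans (sum_le_hasSum _ (fun n _ => ?_) hs) (overProd_le h0 h1 N)
  exact mul_nonneg (coeff_overSeries_nonneg N n) (by positivity)

/-- The generating function `∑ p̄(n) q^n`. -/
noncomputable def overGen (q : ℂ) : ℂ := ∑' n, (pbar n : ℂ) * q ^ n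

theorem tendsto_overProd {q : ℂ} (hq : ‖q‖ < 1) :
    Tendsto (fun N => overProd N q) atTop (𝓝 (overGen q)) := by
  have h : ∀ N, overProd N q = ∑' n, ((PowerSeries.coeff n (overSeries N) : ℝ) : ℂ) * q ^ n :=
    fun N => (evalsTo_overSeries hq N).2.symm
  simp_rw [h]
  refine tendsto_tsum_of_dominated_convergence (summable_pbar (norm_nonneg q) hq) (fun n => ?_) ?_
  · refine Tendsto.mul_const _ ?_
    have := (Complex.continuous_ofReal.tendsto _).comp (tendsto_coeff_overSeries n)
    simpa [Function.comp_def] using this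
  · refine Eventually.of_forall fun N n => ?_
    rw [norm_mul, norm_pow, Complex.norm_real, Real.norm_eq_abs,
      abs_of_nonneg (coeff_overSeries_nonneg N n)]
    gcongr
    exact coeff_overSeries_le N n

theorem norm_overProd_le_exp {q : ℂ} (hq : ‖q‖ < 1) (N : ℕ) :
    ‖overProd N q‖ ≤ exp (2 / (1 - ‖q‖) ^ 2) :=
  (norm_overProd_le hq N).trans (overProd_le (norm_nonneg q) hq N)

/-- Gauss' identity: the generating function is the reciprocal of the theta series. -/
theorem overGen_mul_theta {q T : ℂ} (hq : ‖q‖ < 1)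
    (hT : Tendsto (fun N => thetaPartial N q) atTop (𝓝 T)) : T * overGen q = 1 := by
  have h1 : Tendsto (fun N => thetaPartial N q * overProd N q) atTop (𝓝 (T * overGen q)) :=
    hT.mul (tendsto_overProd hq)
  refine tendsto_nhds_unique h1 ?_
  simp_rw [thetaPartial_mul_overProd (one_sub_pow_ne_zero hq) (one_add_pow_ne_zero hq)]
  have h0 : 0 ≤ ‖q‖ := norm_nonneg q
  have hr : 0 < 1 - ‖q‖ := by linarith
  set B := exp (2 / (1 - ‖q‖) ^ 2)
  have hz : Tendsto (fun n : ℕ => 2 * B / (1 - ‖q‖) * ((n : ℝ) * ‖q‖ ^ n)) atTop (𝓝 0) := by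
    simpa using (tendsto_self_mul_const_pow_of_lt_one h0 hq).const_mul (2 * B / (1 - ‖q‖))
  have hs := squeeze_zero_norm (a := fun n : ℕ => 2 * B / (1 - ‖q‖) * ((n : ℝ) * ‖q‖ ^ n))
    (f := fun n : ℕ => ∑ s ∈ Finset.range n, 2 * (-1) ^ (s + 1) * overProd (s + 1) q /
      (1 + q ^ (s + 1)) * q ^ ((s + 1) * (n + 1))) (fun n => ?_) hz
  · simpa using hs.const_add 1
  · have hterm : ∀ s ∈ Finset.range n, ‖2 * (-1) ^ (s + 1) * overProd (s + 1) q /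
        (1 + q ^ (s + 1)) * q ^ ((s + 1) * (n + 1))‖ ≤ 2 * B / (1 - ‖q‖) * ‖q‖ ^ n := by
      intro s _
      have hp : ‖q‖ ^ (s + 1) ≤ ‖q‖ := by
        simpa using pow_le_pow_of_le_one h0 hq.le (Nat.succ_le_succ (Nat.zero_le s))
      have hd : 1 - ‖q‖ ≤ ‖1 + q ^ (s + 1)‖ := by
        have := norm_sub_norm_le (1 : ℂ) (-q ^ (s + 1))
        simp only [norm_one, norm_neg, norm_pow, sub_neg_eq_add] at this
        linarith
      rw [norm_mul, norm_div, norm_mul, norm_mul, norm_pow, norm_pow, norm_neg, norm_one, one_pow,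
        mul_one, Complex.norm_two]
      have := norm_overProd_le_exp hq (s + 1)
      gcongr ?_ / ?_ * ?_
      · gcongr
      · exact pow_le_pow_of_le_one h0 hq.le (by nlinarith)
    refine (norm_sum_le_of_le _ hterm).trans (le_of_eq ?_)
    rw [Finset.sum_const, Finset.card_range, nsmul_eq_mul]
    ring

theorem norm_one_add_div_one_sub_le {x : ℂ} (hx : ‖x‖ < 1) :
    ‖(1 + x) / (1 - x)‖ ≤ (1 + ‖x‖) / (1 - ‖x‖) * exp (-(2 * (‖x‖ - x.re))) := by
  have hser : ∀ y : ℂ, ‖y‖ < 1 → HasSum (fun n : ℕ => (1 - (-1) ^ n) / n * (y ^ n).re)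
      (Real.log (‖1 + y‖ / ‖1 - y‖)) := by
    intro y hy
    have hy1 : 1 - y ≠ 0 := by simpa using one_sub_pow_ne_zero hy 0
    have hy2 : 1 + y ≠ 0 := by simpa using one_add_pow_ne_zero hy 0
    have h := (Complex.hasSum_taylorSeries_log hy).add (Complex.hasSum_taylorSeries_neg_log hy)
    have h2 := Complex.hasSum_re h
    rw [Complex.add_re, Complex.neg_re, Complex.log_re, Complex.log_re, ← sub_eq_add_neg,
      ← Real.log_div (norm_ne_zero_iff.mpr hy2) (norm_ne_zero_iff.mpr hy1)] at h2
    convert h2 using 2 with n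
    have : (-1 : ℂ) ^ (n + 1) * y ^ n / n + y ^ n / n =
        (((1 - (-1) ^ n) / n : ℝ) : ℂ) * y ^ n := by
      push_cast; ring
    rw [this, Complex.re_ofReal_mul]
  have hx' : ‖((‖x‖ : ℝ) : ℂ)‖ < 1 := by simpa using hx
  have hr : 0 < 1 - ‖x‖ := by linarith
  have hx1 : 0 < ‖1 - x‖ := norm_pos_iff.mpr (by simpa using one_sub_pow_ne_zero hx 0)
  have hx2 : 0 < ‖1 + x‖ := norm_pos_iff.mpr (by simpa using one_add_pow_ne_zero hx 0)
  have e1 : ‖1 + ((‖x‖ : ℝ) : ℂ)‖ / ‖1 - ((‖x‖ : ℝ) : ℂ)‖ = (1 + ‖x‖) / (1 - ‖x‖) := by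
    rw [← Complex.ofReal_one, ← Complex.ofReal_add, ← Complex.ofReal_sub, Complex.norm_real,
      Complex.norm_real, Real.norm_of_nonneg (by positivity), Real.norm_of_nonneg hr.le]
  have hd := (hser _ hx').sub (hser x hx)
  rw [e1] at hd
  have h1 := le_hasSum hd 1 fun n _ => by
    rw [← mul_sub]
    refine mul_nonneg (div_nonneg ?_ (Nat.cast_nonneg n)) ?_
    · rcases neg_one_pow_eq_or ℝ n with h | h <;> rw [h] <;> norm_num
    · rw [← Complex.ofReal_pow, Complex.ofReal_re, ← norm_pow]
      exact sub_nonneg.mpr (Complex.re_le_norm _)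
  have h2 : 2 * (‖x‖ - x.re) ≤
      Real.log ((1 + ‖x‖) / (1 - ‖x‖)) - Real.log (‖1 + x‖ / ‖1 - x‖) := by
    refine le_trans (le_of_eq ?_) h1
    norm_num
    ring
  have h3 : Real.log (‖1 + x‖ / ‖1 - x‖) ≤
      Real.log ((1 + ‖x‖) / (1 - ‖x‖)) + -(2 * (‖x‖ - x.re)) := by linarith
  have h4 := exp_le_exp.mpr h3
  rwa [exp_add, Real.exp_log (by positivity), Real.exp_log (by positivity), ← norm_div] at h4

theorem norm_overGen_le {q : ℂ} (hq : ‖q‖ < 1) :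
    ‖overGen q‖ ≤ ‖overGen ‖q‖‖ * exp (-(2 * ((1 - ‖q‖)⁻¹ - ((1 - q)⁻¹).re))) := by
  have hq' : ‖((‖q‖ : ℝ) : ℂ)‖ < 1 := by simpa using hq
  have h1 : ∀ N, ‖overProd N q‖ ≤ ‖overProd N ((‖q‖ : ℝ) : ℂ)‖ *
      exp (-(2 * (∑ k ∈ Finset.range N, ‖q‖ ^ (k + 1) - (∑ k ∈ Finset.range N, q ^ (k + 1)).re))) := by
    intro N
    rw [← ofReal_overProd, Complex.norm_real, Real.norm_eq_abs,
      abs_of_nonneg (overProd_nonneg (norm_nonneg q) hq N), Complex.re_sum, ← Finset.sum_sub_distrib,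
      Finset.mul_sum, ← Finset.sum_neg_distrib, exp_sum, overProd, overProd, norm_prod,
      ← Finset.prod_mul_distrib]
    refine Finset.prod_le_prod (fun _ _ => norm_nonneg _) fun k _ => ?_
    have := norm_one_add_div_one_sub_le (x := q ^ (k + 1))
      (by rw [norm_pow]; exact pow_lt_one₀ (norm_nonneg q) hq (Nat.succ_ne_zero k))
    rwa [norm_pow] at this
  have g1 : HasSum (fun k => ‖q‖ ^ (k + 1)) ((1 - ‖q‖)⁻¹ - 1) := by
    have := hasSum_geometric_of_lt_one (norm_nonneg q) hq
    rw [← hasSum_nat_add_iff' 1] at this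
    simpa using this
  have g2 : HasSum (fun k => q ^ (k + 1)) ((1 - q)⁻¹ - 1) := by
    have := hasSum_geometric_of_norm_lt_one hq
    rw [← hasSum_nat_add_iff' 1] at this
    simpa using this
  have t1 := g1.tendsto_sum_nat
  have t2 := (Complex.continuous_re.tendsto _).comp g2.tendsto_sum_nat
  have t3 := (tendsto_overProd hq).norm
  have t4 := (tendsto_overProd hq').norm
  have t5 := t4.mul ((continuous_exp.tendsto _).comp (((t1.sub t2).const_mul 2).neg))
  have := le_of_tendsto_of_tendsto' t3 t5 h1
  have e : (1 - ‖q‖)⁻¹ - 1 - ((1 - q)⁻¹ - 1).re = (1 - ‖q‖)⁻¹ - ((1 - q)⁻¹).re := by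
    rw [Complex.sub_re, Complex.one_re]; ring
  rwa [e] at this

theorem norm_cexp_neg_lt_one {z : ℂ} (hz : 0 < z.re) : ‖Complex.exp (-z)‖ < 1 := by
  rw [Complex.norm_exp]
  simpa using hz

theorem hasSum_theta {q : ℂ} (hq : ‖q‖ < 1) :
    ∃ S, HasSum (fun n : ℕ => (-1) ^ (n + 1) * q ^ ((n + 1) ^ 2)) S := by
  refine (Summable.of_norm_bounded (summable_geometric_of_lt_one (norm_nonneg q) hq) fun n => ?_)
  rw [norm_mul, norm_pow, norm_pow, norm_neg, norm_one, one_pow, one_mul]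
  exact pow_le_pow_of_le_one (norm_nonneg q) hq.le (by nlinarith)

theorem cexp_pi_mul_I_mul_nat (n : ℕ) : Complex.exp (π * Complex.I * n) = (-1) ^ n := by
  rw [mul_comm, Complex.exp_nat_mul, Complex.exp_pi_mul_I]

theorem tendsto_thetaPartial {z : ℂ} (hz : 0 < z.re) :
    Tendsto (fun N => thetaPartial N (Complex.exp (-z))) atTop
      (𝓝 (∑' n : ℤ, Complex.exp (-π * (z / π) * n ^ 2 + 2 * π * (Complex.I / 2) * n))) := by
  obtain ⟨S, hS⟩ := hasSum_theta (norm_cexp_neg_lt_one hz)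
  have hpi : (π : ℂ) ≠ 0 := Complex.ofReal_ne_zero.mpr pi_ne_zero
  set f : ℤ → ℂ := fun n => Complex.exp (-π * (z / π) * n ^ 2 + 2 * π * (Complex.I / 2) * n)
  have key : ∀ n : ℕ, (-1) ^ n * Complex.exp (-z) ^ (n ^ 2) = Complex.exp (π * Complex.I * n) *
      Complex.exp (-z * n ^ 2) := by
    intro n
    rw [cexp_pi_mul_I_mul_nat, ← Complex.exp_nat_mul]
    push_cast
    congr 2
    ring
  have h1 : HasSum (fun n : ℕ => f (n + 1)) S := by
    convert hS using 2 with n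
    rw [key, ← Complex.exp_add]
    simp only [f]
    congr 1
    push_cast
    field_simp
    ring
  have h2 : HasSum (fun n : ℕ => f (-(n + 1))) S := by
    convert hS using 2 with n
    have h3 : Complex.exp (-(π * Complex.I * (n + 1 : ℕ))) = (-1) ^ (n + 1) := by
      rw [Complex.exp_neg, cexp_pi_mul_I_mul_nat]
      rcases neg_one_pow_eq_or ℂ (n + 1) with h | h <;> rw [h] <;> norm_num
    rw [← h3, ← Complex.exp_nat_mul, ← Complex.exp_add]
    simp only [f]
    congr 1
    push_cast
    field_simp
    ring
  have h3 := HasSum.of_add_one_of_neg_add_one h1 h2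
  have h4 : f 0 = 1 := by simp [f]
  rw [h3.tsum_eq, h4, show S + 1 + S = 1 + 2 * S by ring]
  exact (hS.tendsto_sum_nat.const_mul 2).const_add 1

theorem norm_cexp_neg_mul_le {w : ℂ} (hw : 0 ≤ w.re) (m : ℕ) :
    ‖Complex.exp (-(w * ((m + 1) * (m + 2))))‖ ≤ exp (-(2 * w.re)) * exp (-(2 * w.re)) ^ m := by
  rw [Complex.norm_exp, ← pow_succ', ← exp_nat_mul]
  apply exp_le_exp.mpr
  have : (w * ((m + 1) * (m + 2)) : ℂ) = (((m + 1) * (m + 2) : ℝ) : ℂ) * w := by push_cast; ring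
  rw [this, Complex.neg_re, Complex.re_ofReal_mul]
  push_cast
  have hm : (0 : ℝ) ≤ m := Nat.cast_nonneg m
  nlinarith [mul_nonneg (mul_nonneg hm hw) (show (0 : ℝ) ≤ m + 1 by linarith)]

theorem tsum_half_int {w : ℂ} (hw : 1 ≤ w.re) :
    ∃ δ : ℂ, ‖δ‖ ≤ 2 * exp (-(2 * w.re)) ∧
      ∑' n : ℤ, Complex.exp (-w * (n - 1 / 2) ^ 2) = 2 * Complex.exp (-w / 4) * (1 + δ) := by
  have hw0 : 0 ≤ w.re := by linarith
  have he : exp (-(2 * w.re)) ≤ 1 / 2 := by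
    have h1 : exp (-(2 * w.re)) ≤ exp (-1) := exp_le_exp.mpr (by linarith)
    have h2 : exp (-1) ≤ 1 / 2 := by
      rw [exp_neg, ← one_div]
      exact one_div_le_one_div_of_le (by norm_num) (by linarith [exp_one_gt_d9])
    exact h1.trans h2
  have hg := (hasSum_geometric_of_lt_one (exp_pos _).le (by linarith : exp (-(2 * w.re)) < 1)).mul_left
    (exp (-(2 * w.re)))
  have hsum : Summable fun m : ℕ => Complex.exp (-(w * ((m + 1) * (m + 2)))) :=
    Summable.of_norm_bounded hg.summable (norm_cexp_neg_mul_le hw0)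
  refine ⟨∑' m : ℕ, Complex.exp (-(w * ((m + 1) * (m + 2)))), ?_, ?_⟩
  · refine (tsum_of_norm_bounded hg (norm_cexp_neg_mul_le hw0)).trans ?_
    rw [mul_comm]
    gcongr
    rw [inv_le_comm₀ (by linarith) (by norm_num)]
    linarith
  · set δ := ∑' m : ℕ, Complex.exp (-(w * ((m + 1) * (m + 2))))
    have h0 : HasSum (fun m : ℕ => Complex.exp (-(w * (m * (m + 1))))) (1 + δ) := by
      have h := hsum.hasSum
      have e : (fun m : ℕ => Complex.exp (-(w * (((m + 1 : ℕ) : ℂ) * (((m + 1 : ℕ) : ℂ) + 1))))) =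
          fun m : ℕ => Complex.exp (-(w * ((m + 1) * (m + 2)))) := by
        ext m
        rw [Nat.cast_add, Nat.cast_one, add_assoc, one_add_one_eq_two]
      have h2 := (hasSum_nat_add_iff (f := fun m : ℕ => Complex.exp (-(w * (m * (m + 1))))) 1
        (g := δ)).mp (by simpa only [e] using h)
      simpa [add_comm] using h2
    have h1 := h0.mul_left (Complex.exp (-w / 4))
    rw [← (Equiv.addRight (1 : ℤ)).tsum_eq]
    have e1 : (fun m : ℕ => Complex.exp (-w * (((Equiv.addRight (1 : ℤ)) (m : ℤ) : ℤ) - 1 / 2) ^ 2)) =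
        fun m : ℕ => Complex.exp (-w / 4) * Complex.exp (-(w * (m * (m + 1)))) := by
      ext m
      rw [← Complex.exp_add]
      congr 1
      simp only [Equiv.coe_addRight, Int.cast_add, Int.cast_natCast, Int.cast_one]
      ring
    have e2 : (fun m : ℕ =>
        Complex.exp (-w * (((Equiv.addRight (1 : ℤ)) (-((m : ℤ) + 1)) : ℤ) - 1 / 2) ^ 2)) =
        fun m : ℕ => Complex.exp (-w / 4) * Complex.exp (-(w * (m * (m + 1)))) := by
      ext m
      rw [← Complex.exp_add]
      congr 1
      simp only [Equiv.coe_addRight, Int.cast_add, Int.cast_neg, Int.cast_natCast, Int.cast_one]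
      ring
    have h2 := HasSum.of_nat_of_neg_add_one
      (f := fun n : ℤ => Complex.exp (-w * (((Equiv.addRight (1 : ℤ)) n : ℤ) - 1 / 2) ^ 2))
      (m := Complex.exp (-w / 4) * (1 + δ)) (m' := Complex.exp (-w / 4) * (1 + δ))
      (by rw [e1]; exact h1) (by rw [e2]; exact h1)
    rw [h2.tsum_eq]
    ring

/-- Behaviour of the generating function near `q = 1`, from the modular transformation of theta. -/
theorem overGen_modular {z : ℂ} (hz : 0 < z.re) (hw : 1 ≤ ((π : ℂ) ^ 2 / z).re) :
    ∃ δ : ℂ, ‖δ‖ ≤ 2 * exp (-(2 * ((π : ℂ) ^ 2 / z).re)) ∧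
      overGen (Complex.exp (-z)) * (1 + δ) =
        (z / π) ^ (1 / 2 : ℂ) * Complex.exp ((π : ℂ) ^ 2 / (4 * z)) / 2 := by
  obtain ⟨δ, h1, h2⟩ := tsum_half_int hw
  refine ⟨δ, h1, ?_⟩
  have hpi : (π : ℂ) ≠ 0 := Complex.ofReal_ne_zero.mpr pi_ne_zero
  have hz0 : z ≠ 0 := fun h => by simp [h] at hz
  have ha : 0 < (z / (π : ℂ)).re := by
    rw [Complex.div_ofReal_re]; exact div_pos hz pi_pos
  have hG := overGen_mul_theta (norm_cexp_neg_lt_one hz) (tendsto_thetaPartial hz)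
  rw [Complex.tsum_exp_neg_quadratic ha] at hG
  have e : ∀ n : ℤ, Complex.exp (-π / (z / π) * (n + Complex.I * (Complex.I / 2)) ^ 2) =
      Complex.exp (-((π : ℂ) ^ 2 / z) * (n - 1 / 2) ^ 2) := by
    intro n
    congr 1
    have : (n : ℂ) + Complex.I * (Complex.I / 2) = n - 1 / 2 := by
      linear_combination (1 / 2 : ℂ) * Complex.I_sq
    rw [this]
    field_simp
  simp_rw [e] at hG
  rw [h2] at hG
  have hc : (z / π : ℂ) ^ (1 / 2 : ℂ) ≠ 0 := by
    rw [Complex.cpow_ne_zero_iff_of_exponent_ne_zero (by norm_num)]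
    exact div_ne_zero hz0 hpi
  have e2 : Complex.exp ((π : ℂ) ^ 2 / (4 * z)) * Complex.exp (-((π : ℂ) ^ 2 / z) / 4) = 1 := by
    rw [← Complex.exp_add, ← Complex.exp_zero]
    congr 1
    field_simp
    ring
  have hG2 : Complex.exp (-((π : ℂ) ^ 2 / z) / 4) * 2 * (1 + δ) * overGen (Complex.exp (-z)) =
      (z / π) ^ (1 / 2 : ℂ) := by
    field_simp at hG ⊢
    linear_combination hG
  rw [← hG2]
  linear_combination (-(overGen (Complex.exp (-z)) * (1 + δ))) * e2

theorem integral_cexp_int_mul_I (k : ℤ) :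
    ∫ θ in (-π)..π, Complex.exp (k * Complex.I * θ) = if k = 0 then (2 * π : ℂ) else 0 := by
  split_ifs with h
  · subst h
    simp [two_mul]
  · have hk : (k * Complex.I : ℂ) ≠ 0 := by simp [h, Complex.I_ne_zero]
    rw [integral_exp_mul_complex hk, div_eq_zero_iff]
    left
    rw [sub_eq_zero, Complex.exp_eq_exp_iff_exists_int]
    exact ⟨k, by push_cast; ring⟩

theorem norm_cexp_neg_add_mul_I (y θ : ℝ) :
    ‖Complex.exp (-(y + θ * Complex.I))‖ = exp (-y) := by
  rw [Complex.norm_exp]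
  simp

theorem continuous_overGen_circle {y : ℝ} (hy : 0 < y) :
    Continuous fun θ : ℝ => overGen (Complex.exp (-(y + θ * Complex.I))) := by
  unfold overGen
  refine continuous_tsum (fun m => by fun_prop)
    (summable_pbar (exp_pos (-y)).le (by simpa using hy)) fun m θ => ?_
  rw [norm_mul, norm_pow, norm_cexp_neg_add_mul_I, Complex.norm_natCast]

theorem integral_overGen_mul_cexp {y : ℝ} (hy : 0 < y) (n : ℕ) :
    ∫ θ in (-π)..π, overGen (Complex.exp (-(y + θ * Complex.I))) *
      Complex.exp (n * (y + θ * Complex.I)) = 2 * π * pbar n := by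
  have hs := (summable_pbar (exp_pos (-y)).le (by simpa using hy)).mul_right (exp (n * y))
  have hterm : ∀ (m : ℕ) (θ : ℝ), (pbar m : ℂ) * Complex.exp (-(y + θ * Complex.I)) ^ m *
      Complex.exp (n * (y + θ * Complex.I)) =
      pbar m * Complex.exp ((n - m) * y) * Complex.exp (((n - m : ℤ) : ℂ) * Complex.I * θ) := by
    intro m θ
    rw [← Complex.exp_nat_mul, mul_assoc, ← Complex.exp_add, mul_assoc, ← Complex.exp_add]
    congr 2
    push_cast
    ring
  have h := intervalIntegral.hasSum_integral_of_dominated_convergence (a := -π) (b := π)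
    (μ := MeasureTheory.volume)
    (F := fun (m : ℕ) (θ : ℝ) => (pbar m : ℂ) * Complex.exp (-(y + θ * Complex.I)) ^ m *
      Complex.exp (n * (y + θ * Complex.I)))
    (f := fun θ : ℝ => overGen (Complex.exp (-(y + θ * Complex.I))) *
      Complex.exp (n * (y + θ * Complex.I)))
    (fun m _ => (pbar m : ℝ) * exp (-y) ^ m * exp (n * y))
    (fun m => Continuous.aestronglyMeasurable (by fun_prop))
    (fun m => MeasureTheory.ae_of_all _ fun θ _ => by
      rw [norm_mul, norm_mul, norm_pow, norm_cexp_neg_add_mul_I, Complex.norm_natCast,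
        Complex.norm_exp]
      simp)
    (MeasureTheory.ae_of_all _ fun θ _ => hs)
    intervalIntegrable_const
    (MeasureTheory.ae_of_all _ fun θ _ => by
      refine HasSum.mul_right _ (Summable.hasSum ?_)
      refine Summable.of_norm_bounded (summable_pbar (exp_pos (-y)).le (by simpa using hy)) fun m => ?_
      rw [norm_mul, norm_pow, norm_cexp_neg_add_mul_I, Complex.norm_natCast])
  refine h.unique ?_
  have h2 : ∀ m : ℕ, ∫ θ in (-π)..π, (pbar m : ℂ) * Complex.exp (-(y + θ * Complex.I)) ^ m *
      Complex.exp (n * (y + θ * Complex.I)) = if m = n then (2 * π * pbar n : ℂ) else 0 := by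
    intro m
    simp_rw [hterm m]
    rw [intervalIntegral.integral_const_mul, integral_cexp_int_mul_I]
    by_cases hm : m = n
    · subst hm
      simp [mul_comm]
    · rw [if_neg (by omega), if_neg hm, mul_zero]
  simp_rw [h2]
  exact hasSum_ite_eq n _

theorem exists_primitive_cexp_sq :
    ∃ F : ℂ → ℂ, F 0 = 0 ∧ ∀ s, HasDerivAt F (Complex.exp (s ^ 2)) s := by
  obtain ⟨F, hF⟩ := Differentiable.isExactOn_univ
    (f := fun s : ℂ => Complex.exp (s ^ 2)) (by fun_prop)
  exact ⟨fun s => F s - F 0, by simp, fun s => (hF s (Set.mem_univ s)).sub_const _⟩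

theorem norm_primitive_cexp_sq_le {F : ℂ → ℂ} (h0 : F 0 = 0)
    (hF : ∀ s, HasDerivAt F (Complex.exp (s ^ 2)) s) {t : ℂ} (ht : 0 ≤ (t ^ 2).re) :
    ‖F t‖ ≤ ‖t‖ * exp ((t ^ 2).re) := by
  have hd : ∀ u ∈ Set.Icc (0 : ℝ) 1,
      HasDerivWithinAt (fun u : ℝ => F (u * t)) (Complex.exp ((u * t) ^ 2) * t) (Set.Icc 0 1) u := by
    intro u _
    have h1 : HasDerivAt (fun u : ℝ => (u : ℂ) * t) t u := by
      simpa using (Complex.ofRealCLM.hasDerivAt (x := u)).mul_const t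
    exact ((hF _).comp u h1).hasDerivWithinAt
  have hb : ∀ u ∈ Set.Ico (0 : ℝ) 1,
      ‖Complex.exp (((u : ℂ) * t) ^ 2) * t‖ ≤ ‖t‖ * exp ((t ^ 2).re) := by
    intro u hu
    rw [norm_mul, mul_comm, Complex.norm_exp, mul_pow, ← Complex.ofReal_pow, Complex.re_ofReal_mul]
    have : u ^ 2 ≤ 1 := by nlinarith [hu.1, hu.2]
    gcongr
    nlinarith
  simpa [h0] using norm_image_sub_le_of_norm_deriv_le_segment_01' hd hb

theorem norm_primitive_cexp_sq_sub_le {F : ℂ → ℂ}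
    (hF : ∀ s, HasDerivAt F (Complex.exp (s ^ 2)) s) (x : ℝ) {T : ℝ} (hT : 0 ≤ T) :
    ‖F (x + T * Complex.I) - F (x - T * Complex.I) - Complex.I * √π‖ ≤
      2 * √π * exp (x ^ 2 - T ^ 2) := by
  set g : ℝ → ℂ := fun v => Complex.exp ((x + v * Complex.I) ^ 2) with hg
  have hgn : ∀ v, ‖g v‖ = exp (x ^ 2 - v ^ 2) := by
    intro v
    rw [hg, Complex.norm_exp]
    congr 1
    simp [pow_two]
  have hreal : Integrable fun v : ℝ => exp (x ^ 2 - v ^ 2) := by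
    have := (integrable_exp_neg_mul_sq (b := 1) one_pos).const_mul (exp (x ^ 2))
    refine this.congr (ae_of_all _ fun v => ?_)
    simp only
    rw [← exp_add]
    ring_nf
  have hgc : Continuous g := by fun_prop
  have hgi : Integrable g := by
    refine hreal.mono hgc.aestronglyMeasurable (ae_of_all _ fun v => ?_)
    rw [hgn, Real.norm_eq_abs, abs_of_pos (exp_pos _)]
  have hfull : ∫ v, g v = √π := by
    have h := GaussianFourier.integral_cexp_neg_mul_sq_add_real_mul_I (b := 1) (by simp) (-x)
    have e : ∀ v : ℝ, Complex.exp (-1 * (v + (-x : ℝ) * Complex.I) ^ 2) = g v := by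
      intro v
      rw [hg]
      congr 1
      push_cast
      linear_combination (-((v : ℂ) ^ 2 + x ^ 2)) * Complex.I_sq
    simp_rw [e] at h
    rw [h, div_one, sqrt_eq_rpow, Complex.ofReal_cpow pi_pos.le]
    norm_num
  have hFTC : Complex.I * ∫ v in (-T)..T, g v = F (x + T * Complex.I) - F (x - T * Complex.I) := by
    have hd : ∀ v : ℝ, HasDerivAt (fun v : ℝ => F (x + v * Complex.I)) (g v * Complex.I) v := by
      intro v
      have h1 : HasDerivAt (fun v : ℝ => (x : ℂ) + v * Complex.I) Complex.I v := by
        simpa using ((Complex.ofRealCLM.hasDerivAt (x := v)).mul_const Complex.I).const_add (x : ℂ)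
      exact (hF _).comp v h1
    have := intervalIntegral.integral_eq_sub_of_hasDerivAt (a := -T) (b := T) (fun v _ => hd v)
      ((hgc.mul continuous_const).intervalIntegrable _ _)
    rw [intervalIntegral.integral_mul_const] at this
    rw [mul_comm, this]
    congr 2
    push_cast
    ring
  have hsplit : (∫ v in Set.Iic (-T), g v) + (∫ v in (-T)..T, g v) + ∫ v in Set.Ioi T, g v = √π := by
    rw [← intervalIntegral.integral_Iic_sub_Iic hgi.integrableOn hgi.integrableOn,
      add_sub_cancel, intervalIntegral.integral_Iic_add_Ioi hgi.integrableOn hgi.integrableOn, hfull]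
  have htail : ∀ c : ℝ, ∀ S : Set ℝ, MeasurableSet S → c ^ 2 = T ^ 2 →
      (∀ v ∈ S, T ^ 2 + (v - c) ^ 2 ≤ v ^ 2) →
      ‖∫ v in S, g v‖ ≤ √π * exp (x ^ 2 - T ^ 2) := by
    intro c S hS hc hv
    have hi : Integrable fun v : ℝ => exp (x ^ 2 - T ^ 2) * exp (-1 * (v - c) ^ 2) :=
      ((integrable_exp_neg_mul_sq (b := 1) one_pos).comp_sub_right c).const_mul _
    calc ‖∫ v in S, g v‖ ≤ ∫ v in S, exp (x ^ 2 - T ^ 2) * exp (-1 * (v - c) ^ 2) := by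
          refine norm_integral_le_of_norm_le hi.integrableOn
            ((ae_restrict_iff' hS).mpr (ae_of_all _ fun v hvS => ?_))
          rw [hgn, ← exp_add, exp_le_exp]
          linarith [hv v hvS]
      _ ≤ ∫ v, exp (x ^ 2 - T ^ 2) * exp (-1 * (v - c) ^ 2) :=
          setIntegral_le_integral hi (ae_of_all _ fun v => by positivity)
      _ = √π * exp (x ^ 2 - T ^ 2) := by
          rw [integral_const_mul, integral_sub_right_eq_self (fun v : ℝ => exp (-1 * v ^ 2)) c,
            integral_gaussian, div_one, mul_comm]
  have e : F (x + T * Complex.I) - F (x - T * Complex.I) - Complex.I * √π =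
      -(Complex.I * ((∫ v in Set.Iic (-T), g v) + ∫ v in Set.Ioi T, g v)) := by
    rw [← hFTC, ← hsplit]
    ring
  rw [e, norm_neg, norm_mul, Complex.norm_I, one_mul]
  refine (norm_add_le _ _).trans ?_
  have h1 := htail (-T) (Set.Iic (-T)) measurableSet_Iic (by ring) fun v hv => by
    have : v ≤ -T := hv
    nlinarith
  have h2 := htail T (Set.Ioi T) measurableSet_Ioi rfl fun v hv => by
    have : T < v := hv
    nlinarith
  linarith

/-- The primitive, in `w = z ^ (1/2)`, of the main arc integrand; `F` is a primitive of
`exp (s ^ 2)`. -/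
noncomputable def saddlePrim (F : ℂ → ℂ) (N : ℝ) (w : ℂ) : ℂ :=
  w * Complex.exp (N ^ 2 * w ^ 2 + π ^ 2 / (4 * w ^ 2)) +
    (π / 2 - 1 / (2 * N)) * Complex.exp (π * N) * F (N * w - π / (2 * w)) -
    (π / 2 + 1 / (2 * N)) * Complex.exp (-(π * N)) * F (N * w + π / (2 * w))

theorem hasDerivAt_saddlePrim {F : ℂ → ℂ} (hF : ∀ s, HasDerivAt F (Complex.exp (s ^ 2)) s)
    {N : ℝ} (hN : N ≠ 0) {w : ℂ} (hw : w ≠ 0) :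
    HasDerivAt (saddlePrim F N)
      (2 * w * (N ^ 2 * (w * Complex.exp (N ^ 2 * w ^ 2 + π ^ 2 / (4 * w ^ 2))))) w := by
  have hN' : (N : ℂ) ≠ 0 := Complex.ofReal_ne_zero.mpr hN
  have hinv : HasDerivAt (fun w : ℂ => π / (2 * w)) (-(π / (2 * w ^ 2))) w := by
    have := ((hasDerivAt_inv hw).const_mul (π / 2 : ℂ))
    refine (this.congr_deriv ?_).congr_of_eventuallyEq (Eventually.of_forall fun x => ?_)
    · field_simp
    · simp only [div_eq_mul_inv, mul_inv]; ring
  have hlin : HasDerivAt (fun w : ℂ => N * w) N w := by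
    simpa using (hasDerivAt_id w).const_mul (N : ℂ)
  have hs := hlin.sub hinv
  have ht := hlin.add hinv
  have hE : HasDerivAt (fun w : ℂ => (N ^ 2 * w ^ 2 + π ^ 2 / (4 * w ^ 2) : ℂ))
      (2 * N ^ 2 * w - π ^ 2 / (2 * w ^ 3)) w := by
    have := (hlin.pow 2).add (hinv.pow 2)
    refine (this.congr_deriv ?_).congr_of_eventuallyEq (Eventually.of_forall fun x => ?_)
    · norm_num
      field_simp
      ring
    · simp only [Pi.add_apply, Pi.pow_apply, mul_pow, div_pow]
      norm_num
  have h := (((hasDerivAt_id w).mul hE.cexp).add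
    (((hF _).comp w hs).const_mul ((π / 2 - 1 / (2 * N) : ℂ) * Complex.exp (π * N)))).sub
    (((hF _).comp w ht).const_mul ((π / 2 + 1 / (2 * N) : ℂ) * Complex.exp (-(π * N))))
  refine h.congr_deriv ?_
  have e1 : Complex.exp (π * N) * Complex.exp ((N * w - π / (2 * w)) ^ 2) =
      Complex.exp (N ^ 2 * w ^ 2 + π ^ 2 / (4 * w ^ 2)) := by
    rw [← Complex.exp_add]
    congr 1
    field_simp
    ring
  have e2 : Complex.exp (-(π * N)) * Complex.exp ((N * w + π / (2 * w)) ^ 2) =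
      Complex.exp (N ^ 2 * w ^ 2 + π ^ 2 / (4 * w ^ 2)) := by
    rw [← Complex.exp_add]
    congr 1
    field_simp
    ring
  simp only [id, Pi.sub_apply, Pi.add_apply]
  calc _ = Complex.exp (N ^ 2 * w ^ 2 + π ^ 2 / (4 * w ^ 2)) +
        w * (Complex.exp (N ^ 2 * w ^ 2 + π ^ 2 / (4 * w ^ 2)) *
          (2 * N ^ 2 * w - π ^ 2 / (2 * w ^ 3))) +
        (π / 2 - 1 / (2 * N)) * (Complex.exp (π * N) * Complex.exp ((N * w - π / (2 * w)) ^ 2)) *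
          (N - -(π / (2 * w ^ 2))) -
        (π / 2 + 1 / (2 * N)) * (Complex.exp (-(π * N)) * Complex.exp ((N * w + π / (2 * w)) ^ 2)) *
          (N + -(π / (2 * w ^ 2))) := by ring
    _ = _ := by
        rw [e1, e2]
        field_simp
        ring

/-- The square root of `y + iθ`. -/
noncomputable def sqrtLine (y θ : ℝ) : ℂ := √π * (((y : ℂ) + θ * Complex.I) / π) ^ (1 / 2 : ℂ)

theorem sqrtLine_sq (y θ : ℝ) : sqrtLine y θ ^ 2 = y + θ * Complex.I := by
  have hpi : (π : ℂ) ≠ 0 := Complex.ofReal_ne_zero.mpr pi_ne_zero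
  rw [sqrtLine, mul_pow, one_div, Complex.cpow_ofNat_inv_pow, ← Complex.ofReal_pow,
    sq_sqrt pi_pos.le, mul_div_cancel₀ _ hpi]

theorem sqrtLine_re_pos {y : ℝ} (hy : 0 < y) (θ : ℝ) : 0 < (sqrtLine y θ).re := by
  rw [sqrtLine, Complex.re_ofReal_mul]
  have h : 0 < (((y : ℂ) + θ * Complex.I) / π).re := by
    rw [Complex.div_ofReal_re]
    simpa using div_pos hy pi_pos
  rw [one_div, Complex.cpow_inv_two_re]
  exact mul_pos (sqrt_pos.mpr pi_pos)
    (sqrt_pos.mpr (half_pos (add_pos_of_nonneg_of_pos (norm_nonneg _) h)))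

theorem sqrtLine_ne_zero {y : ℝ} (hy : 0 < y) (θ : ℝ) : sqrtLine y θ ≠ 0 := fun h => by
  have := sqrtLine_re_pos hy θ
  simp [h] at this

theorem norm_sqrtLine_sq (y θ : ℝ) : ‖sqrtLine y θ‖ ^ 2 = ‖(y : ℂ) + θ * Complex.I‖ := by
  rw [← norm_pow, sqrtLine_sq]

theorem hasDerivAt_sqrtLine {y : ℝ} (hy : 0 < y) (θ : ℝ) :
    HasDerivAt (sqrtLine y) (Complex.I / (2 * sqrtLine y θ)) θ := by
  have hline : HasDerivAt (fun θ : ℝ => (y : ℂ) + θ * Complex.I) Complex.I θ := by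
    simpa using ((Complex.ofRealCLM.hasDerivAt (x := θ)).mul_const Complex.I).const_add (y : ℂ)
  have hslit : ((y : ℂ) + θ * Complex.I) / π ∈ Complex.slitPlane := by
    left
    rw [Complex.div_ofReal_re]
    simpa using div_pos hy pi_pos
  have hc := (hasDerivAt_id (((y : ℂ) + θ * Complex.I) / π)).cpow_const (c := (1 / 2 : ℂ)) hslit
  have hd := (hc.comp θ (hline.div_const (π : ℂ))).const_mul (√π : ℂ)
  have hd' : DifferentiableAt ℝ (sqrtLine y) θ := hd.differentiableAt
  have h2 := hd'.hasDerivAt.pow 2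
  have h3 : HasDerivAt (sqrtLine y ^ 2) Complex.I θ := by
    refine hline.congr_of_eventuallyEq (Eventually.of_forall fun x => ?_)
    simp [sqrtLine_sq]
  have h4 := h2.unique h3
  have h0 := sqrtLine_ne_zero hy θ
  have h5 : deriv (sqrtLine y) θ = Complex.I / (2 * sqrtLine y θ) := by
    field_simp
    simp at h4
    linear_combination h4
  rw [← h5]
  exact hd'.hasDerivAt

theorem sqrtLine_neg {y : ℝ} (hy : 0 < y) (θ : ℝ) :
    sqrtLine y (-θ) = (starRingEnd ℂ) (sqrtLine y θ) := by
  have h : (sqrtLine y (-θ) - (starRingEnd ℂ) (sqrtLine y θ)) *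
      (sqrtLine y (-θ) + (starRingEnd ℂ) (sqrtLine y θ)) = 0 := by
    have := sqrtLine_sq y (-θ)
    have h2 := congrArg (starRingEnd ℂ) (sqrtLine_sq y θ)
    simp at h2 this
    linear_combination this - h2
  rcases mul_eq_zero.mp h with h | h
  · exact sub_eq_zero.mp h
  · have := congrArg Complex.re h
    have h1 := sqrtLine_re_pos hy θ
    have h2 := sqrtLine_re_pos hy (-θ)
    simp at this
    linarith

theorem sqrtLine_im_pos {y : ℝ} (hy : 0 < y) {θ : ℝ} (hθ : 0 < θ) : 0 < (sqrtLine y θ).im := by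
  have h := congrArg Complex.im (sqrtLine_sq y θ)
  have h1 := sqrtLine_re_pos hy θ
  simp [pow_two] at h
  by_contra hc
  nlinarith

theorem norm_main_arc_sub_le {N : ℝ} (hN : 10 ≤ N) :
    ‖(N : ℂ) ^ 2 * (∫ θ in (-(π / (2 * N)))..(π / (2 * N)), sqrtLine (π / (2 * N)) θ *
        Complex.exp (N ^ 2 * sqrtLine (π / (2 * N)) θ ^ 2 +
          π ^ 2 / (4 * sqrtLine (π / (2 * N)) θ ^ 2))) -
      √π * (π / 2 - 1 / (2 * N)) * Complex.exp (π * N)‖ ≤ 5 * N * exp (3 * π * N / 4) := by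
  have hN0 : N ≠ 0 := by linarith
  have hNC : (N : ℂ) ≠ 0 := Complex.ofReal_ne_zero.mpr hN0
  have hpC : (π : ℂ) ≠ 0 := Complex.ofReal_ne_zero.mpr pi_ne_zero
  have hp4 := pi_lt_four
  have hp3 := pi_gt_three
  set y := π / (2 * N) with hy
  have hy0 : 0 < y := by positivity
  have hyN : (y : ℂ) = π / (2 * N) := by rw [hy]; push_cast; rfl
  obtain ⟨F, hF0, hF⟩ := exists_primitive_cexp_sq
  set W := sqrtLine y y with hW
  have hW0 : W ≠ 0 := sqrtLine_ne_zero hy0 y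
  have hWsq : W ^ 2 = y * (1 + Complex.I) := by rw [hW, sqrtLine_sq]; ring
  have hI1 : (1 + Complex.I) ≠ 0 := fun h => by simpa using congrArg Complex.re h
  have hE : (N : ℂ) ^ 2 * W ^ 2 + π ^ 2 / (4 * W ^ 2) = (π * N : ℝ) * (3 / 4 + Complex.I / 4) := by
    have : (W ^ 2)⁻¹ = N / π * (1 - Complex.I) := by
      rw [hWsq, hyN]
      field_simp
      linear_combination (1 : ℂ) * Complex.I_sq
    rw [div_eq_mul_inv, mul_inv, this, hWsq, hyN]
    push_cast
    field_simp
    ring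
  set s := (N : ℂ) * W - π / (2 * W) with hs
  set t := (N : ℂ) * W + π / (2 * W) with ht
  have hs2 : s ^ 2 = (π * N : ℝ) * (-1 / 4 + Complex.I / 4) := by
    have : s ^ 2 = (N : ℂ) ^ 2 * W ^ 2 + π ^ 2 / (4 * W ^ 2) - π * N := by
      rw [hs]; field_simp; ring
    rw [this, hE]; push_cast; ring
  have ht2 : t ^ 2 = (π * N : ℝ) * (7 / 4 + Complex.I / 4) := by
    have : t ^ 2 = (N : ℂ) ^ 2 * W ^ 2 + π ^ 2 / (4 * W ^ 2) + π * N := by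
      rw [ht]; field_simp; ring
    rw [this, hE]; push_cast; ring
  have hT : 0 ≤ s.im := by
    have h1 := sqrtLine_im_pos hy0 hy0
    have : s.im = N * W.im + π / 2 * (W.im / Complex.normSq W) := by
      have e : (π : ℂ) / (2 * W) = ((π / 2 : ℝ) : ℂ) * W⁻¹ := by
        push_cast; field_simp
      rw [hs, Complex.sub_im, Complex.im_ofReal_mul, e, Complex.im_ofReal_mul, Complex.inv_im]
      ring
    rw [this]
    have := Complex.normSq_nonneg W
    positivity
  have hxT : s.re ^ 2 - s.im ^ 2 = -(π * N / 4) := by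
    have := congrArg Complex.re hs2
    rw [Complex.re_ofReal_mul] at this
    simp [pow_two] at this
    linarith
  have htre : (t ^ 2).re = 7 * π * N / 4 := by
    rw [ht2, Complex.re_ofReal_mul]
    simp
    ring
  have htn : ‖t‖ ≤ N := by
    have h1 : ‖t‖ ^ 2 ≤ N ^ 2 := by
      rw [← norm_pow, ht2, norm_mul, Complex.norm_real, Real.norm_eq_abs,
        abs_of_pos (by positivity)]
      have h2 : ‖(7 / 4 + Complex.I / 4 : ℂ)‖ ≤ 2 := by
        refine (norm_add_le _ _).trans ?_
        norm_num
      nlinarith [mul_le_mul_of_nonneg_left h2 (by positivity : 0 ≤ π * N)]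
    exact (pow_le_pow_iff_left₀ (norm_nonneg _) (by linarith) two_ne_zero).mp h1
  have hWn : ‖W‖ ≤ 1 := by
    have h1 : ‖W‖ ^ 2 ≤ 1 ^ 2 := by
      rw [← norm_pow, hWsq, norm_mul, Complex.norm_real, Real.norm_eq_abs, abs_of_pos hy0]
      have h2 : ‖(1 + Complex.I : ℂ)‖ ≤ 2 := by
        refine (norm_add_le _ _).trans ?_
        norm_num
      have h3 : y ≤ 1 / 2 := by
        rw [hy, div_le_iff₀ (by positivity)]; linarith
      nlinarith
    exact (pow_le_pow_iff_left₀ (norm_nonneg _) (by norm_num) two_ne_zero).mp h1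
  have hneg : sqrtLine y (-y) = (starRingEnd ℂ) W := sqrtLine_neg hy0 y
  have hFTC : Complex.I * ((N : ℂ) ^ 2 * (∫ θ in (-y)..y, sqrtLine y θ *
        Complex.exp (N ^ 2 * sqrtLine y θ ^ 2 + π ^ 2 / (4 * sqrtLine y θ ^ 2)))) =
      saddlePrim F N W - saddlePrim F N ((starRingEnd ℂ) W) := by
    have hd : ∀ θ : ℝ, HasDerivAt (fun θ => saddlePrim F N (sqrtLine y θ))
        (Complex.I * ((N : ℂ) ^ 2 * (sqrtLine y θ *
          Complex.exp (N ^ 2 * sqrtLine y θ ^ 2 + π ^ 2 / (4 * sqrtLine y θ ^ 2))))) θ := by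
      intro θ
      have h0 := sqrtLine_ne_zero hy0 θ
      refine ((hasDerivAt_saddlePrim hF hN0 h0).comp θ (hasDerivAt_sqrtLine hy0 θ)).congr_deriv ?_
      field_simp
    have hcs : Continuous (sqrtLine y) :=
      continuous_iff_continuousAt.mpr fun θ => (hasDerivAt_sqrtLine hy0 θ).continuousAt
    have hne : ∀ θ, 4 * sqrtLine y θ ^ 2 ≠ 0 := fun θ =>
      mul_ne_zero (by norm_num) (pow_ne_zero 2 (sqrtLine_ne_zero hy0 θ))
    have hcont : Continuous fun θ => Complex.I * ((N : ℂ) ^ 2 * (sqrtLine y θ *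
          Complex.exp (N ^ 2 * sqrtLine y θ ^ 2 + π ^ 2 / (4 * sqrtLine y θ ^ 2)))) := by
      have := Continuous.div (continuous_const (y := (π : ℂ) ^ 2)) (by fun_prop) hne
      fun_prop
    have := intervalIntegral.integral_eq_sub_of_hasDerivAt (a := -y) (b := y) (fun θ _ => hd θ)
      (hcont.intervalIntegrable _ _)
    rw [intervalIntegral.integral_const_mul, intervalIntegral.integral_const_mul, hneg] at this
    exact this
  have hsx : s = s.re + s.im * Complex.I := (Complex.re_add_im s).symm
  have hsc : (N : ℂ) * (starRingEnd ℂ) W - π / (2 * (starRingEnd ℂ) W) =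
      s.re - s.im * Complex.I := by
    have h1 : (N : ℂ) * (starRingEnd ℂ) W - π / (2 * (starRingEnd ℂ) W) = (starRingEnd ℂ) s := by
      rw [hs]; simp [map_ofNat]
    rw [h1]
    apply Complex.ext <;> simp
  have htc : (N : ℂ) * (starRingEnd ℂ) W + π / (2 * (starRingEnd ℂ) W) = (starRingEnd ℂ) t := by
    rw [ht]; simp [map_ofNat]
  have hFs := norm_primitive_cexp_sq_sub_le hF s.re hT
  rw [← hsx, hxT] at hFs
  set D := F s - F (s.re - s.im * Complex.I) - Complex.I * √π with hD
  have hFt : ‖F t‖ ≤ N * exp (7 * π * N / 4) := by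
    refine (norm_primitive_cexp_sq_le hF0 hF (by rw [htre]; positivity)).trans ?_
    rw [htre]
    gcongr
  have hFtc : ‖F ((starRingEnd ℂ) t)‖ ≤ N * exp (7 * π * N / 4) := by
    have e : (((starRingEnd ℂ) t) ^ 2).re = 7 * π * N / 4 := by
      rw [← map_pow, Complex.conj_re, htre]
    refine (norm_primitive_cexp_sq_le hF0 hF (by rw [e]; positivity)).trans ?_
    rw [e, Complex.norm_conj]
    gcongr
  set E := (N : ℂ) ^ 2 * W ^ 2 + π ^ 2 / (4 * W ^ 2) with hEdef
  have hEre : E.re = 3 * π * N / 4 := by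
    rw [hE, Complex.re_ofReal_mul]; simp; ring
  have hEc : (N : ℂ) ^ 2 * (starRingEnd ℂ) W ^ 2 + π ^ 2 / (4 * (starRingEnd ℂ) W ^ 2) =
      (starRingEnd ℂ) E := by
    rw [hEdef]; simp [map_ofNat]
  set A : ℂ := π / 2 - 1 / (2 * N) with hA
  set B : ℂ := π / 2 + 1 / (2 * N) with hB
  have hid : Complex.I * ((N : ℂ) ^ 2 * (∫ θ in (-y)..y, sqrtLine y θ *
        Complex.exp (N ^ 2 * sqrtLine y θ ^ 2 + π ^ 2 / (4 * sqrtLine y θ ^ 2))) -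
      √π * A * Complex.exp (π * N)) =
      (W * Complex.exp E - (starRingEnd ℂ) W * Complex.exp ((starRingEnd ℂ) E)) +
        A * Complex.exp (π * N) * D -
        B * Complex.exp (-(π * N)) * (F t - F ((starRingEnd ℂ) t)) := by
    rw [mul_sub, hFTC, saddlePrim, saddlePrim, hsc, htc, hEc, hD]
    ring
  rw [← one_mul (‖_‖), ← Complex.norm_I, ← norm_mul, hid]
  have hinv : 1 / (2 * N) ≤ 1 := by
    rw [div_le_one (by positivity)]; linarith
  have hinv0 : 0 ≤ 1 / (2 * N) := by positivity
  have hAn : ‖A‖ ≤ 2 := by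
    have : A = ((π / 2 - 1 / (2 * N) : ℝ) : ℂ) := by rw [hA]; push_cast; rfl
    rw [this, Complex.norm_real, Real.norm_eq_abs, abs_le]
    constructor <;> linarith
  have hBn : ‖B‖ ≤ 2 := by
    have : B = ((π / 2 + 1 / (2 * N) : ℝ) : ℂ) := by rw [hB]; push_cast; rfl
    have h8 : 1 / (2 * N) ≤ 1 / (2 * 8) := by gcongr; linarith
    have hp := pi_lt_d2
    rw [this, Complex.norm_real, Real.norm_eq_abs, abs_le]
    constructor <;> linarith
  have hexp1 : ‖Complex.exp (π * N)‖ = exp (π * N) := by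
    rw [← Complex.ofReal_mul, Complex.norm_exp, Complex.ofReal_re]
  have hexp2 : ‖Complex.exp (-(π * N))‖ = exp (-(π * N)) := by
    rw [← Complex.ofReal_mul, ← Complex.ofReal_neg, Complex.norm_exp, Complex.ofReal_re]
  have hsp : √π ≤ 2 := by
    rw [sqrt_le_left (by norm_num)]; linarith
  set X := exp (3 * π * N / 4) with hX
  have hX0 : 0 < X := exp_pos _
  have b1 : ‖W * Complex.exp E‖ ≤ X := by
    rw [norm_mul, Complex.norm_exp, hEre]
    exact mul_le_of_le_one_left hX0.le hWn
  have b2 : ‖(starRingEnd ℂ) W * Complex.exp ((starRingEnd ℂ) E)‖ ≤ X := by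
    rw [norm_mul, Complex.norm_exp, Complex.conj_re, Complex.norm_conj, hEre]
    exact mul_le_of_le_one_left hX0.le hWn
  have b3 : ‖A * Complex.exp (π * N) * D‖ ≤ 8 * X := by
    rw [norm_mul, norm_mul, hexp1]
    calc ‖A‖ * exp (π * N) * ‖D‖ ≤ 2 * exp (π * N) * (2 * 2 * exp (-(π * N / 4))) := by
          gcongr
          exact hFs.trans (by gcongr)
      _ = 8 * (exp (π * N) * exp (-(π * N / 4))) := by ring
      _ = 8 * X := by rw [← exp_add, hX]; ring_nf
  have b4 : ‖B * Complex.exp (-(π * N)) * (F t - F ((starRingEnd ℂ) t))‖ ≤ 4 * N * X := by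
    rw [norm_mul, norm_mul, hexp2]
    calc ‖B‖ * exp (-(π * N)) * ‖F t - F ((starRingEnd ℂ) t)‖ ≤
          2 * exp (-(π * N)) * (N * exp (7 * π * N / 4) + N * exp (7 * π * N / 4)) := by
          gcongr
          exact (norm_sub_le _ _).trans (add_le_add hFt hFtc)
      _ = 4 * N * (exp (-(π * N)) * exp (7 * π * N / 4)) := by ring
      _ = 4 * N * X := by rw [← exp_add, hX]; ring_nf
  refine (norm_sub_le _ _).trans ?_
  have := norm_add_le (W * Complex.exp E - (starRingEnd ℂ) W * Complex.exp ((starRingEnd ℂ) E))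
    (A * Complex.exp (π * N) * D)
  have := norm_sub_le (W * Complex.exp E) ((starRingEnd ℂ) W * Complex.exp ((starRingEnd ℂ) E))
  nlinarith

theorem re_sq_pi_div {y : ℝ} (θ : ℝ) :
    ((π : ℂ) ^ 2 / (y + θ * Complex.I)).re = π ^ 2 * y / (y ^ 2 + θ ^ 2) := by
  rw [← Complex.ofReal_pow, div_eq_mul_inv, Complex.re_ofReal_mul, Complex.inv_re]
  simp [Complex.normSq_apply, mul_div_assoc, pow_two]

/-- The leading approximation of the integrand near the saddle point. -/
noncomputable def arcMain (N y θ : ℝ) : ℂ :=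
  1 / (2 * √π) * (sqrtLine y θ *
    Complex.exp (N ^ 2 * sqrtLine y θ ^ 2 + π ^ 2 / (4 * sqrtLine y θ ^ 2)))

theorem norm_arcMain_le {N : ℝ} (hN : 10 ≤ N) {θ : ℝ} (hθ : |θ| ≤ π / (2 * N)) :
    ‖arcMain N (π / (2 * N)) θ‖ ≤ exp (π * N) / 2 := by
  have hp4 := pi_lt_four
  have hp3 := pi_gt_three
  set y := π / (2 * N) with hy
  have hy0 : 0 < y := by positivity
  have hy1 : y ≤ 1 / 2 := by
    rw [hy, div_le_iff₀ (by positivity)]; linarith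
  have hw : ‖sqrtLine y θ‖ ≤ 1 := by
    have h1 : ‖sqrtLine y θ‖ ^ 2 ≤ 1 ^ 2 := by
      rw [norm_sqrtLine_sq]
      refine (norm_add_le _ _).trans ?_
      rw [norm_mul, Complex.norm_I, Complex.norm_real, Complex.norm_real, Real.norm_eq_abs,
        Real.norm_eq_abs, abs_of_pos hy0]
      linarith
    exact (pow_le_pow_iff_left₀ (norm_nonneg _) (by norm_num) two_ne_zero).mp h1
  have hsp : 1 ≤ √π := by
    rw [one_le_sqrt]; linarith
  have hre : (N ^ 2 * sqrtLine y θ ^ 2 + π ^ 2 / (4 * sqrtLine y θ ^ 2) : ℂ).re ≤ π * N := by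
    have e : (π : ℂ) ^ 2 / (4 * sqrtLine y θ ^ 2) =
        ((1 / 4 : ℝ) : ℂ) * (π ^ 2 / (y + θ * Complex.I)) := by
      rw [sqrtLine_sq]; push_cast; field_simp
    rw [Complex.add_re, e, Complex.re_ofReal_mul, re_sq_pi_div, sqrtLine_sq, ← Complex.ofReal_pow,
      Complex.re_ofReal_mul]
    have h1 : π ^ 2 * y / (y ^ 2 + θ ^ 2) ≤ 2 * (π * N) := by
      rw [div_le_iff₀ (by positivity)]
      have : 2 * (π * N) * y ^ 2 = π ^ 2 * y := by
        rw [hy]; field_simp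
      nlinarith [mul_nonneg (by positivity : 0 ≤ 2 * (π * N)) (sq_nonneg θ)]
    have h2 : N ^ 2 * y = π * N / 2 := by
      rw [hy]; field_simp
    simp only [Complex.add_re, Complex.ofReal_re, Complex.mul_re, Complex.I_re, Complex.ofReal_im,
      Complex.I_im]
    linarith
  rw [arcMain, norm_mul, norm_mul, Complex.norm_exp]
  have h3 : ‖(1 / (2 * √π) : ℂ)‖ ≤ 1 / 2 := by
    rw [← Complex.ofReal_ofNat, ← Complex.ofReal_mul, ← Complex.ofReal_one, ← Complex.ofReal_div,
      Complex.norm_real, Real.norm_eq_abs, abs_of_pos (by positivity)]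
    exact one_div_le_one_div_of_le (by norm_num) (by linarith)
  calc _ ≤ 1 / 2 * (1 * exp (π * N)) := by gcongr
    _ = _ := by ring

theorem arcMain_approx {N : ℝ} (hN : 10 ≤ N) {n : ℕ} (hn : N ^ 2 = n) {θ : ℝ}
    (hθ : |θ| ≤ π / (2 * N)) :
    ∃ δ : ℂ, ‖δ‖ ≤ 2 * exp (-(2 * (π * N))) ∧
      overGen (Complex.exp (-((π / (2 * N) : ℝ) + θ * Complex.I))) *
        Complex.exp (n * ((π / (2 * N) : ℝ) + θ * Complex.I)) * (1 + δ) =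
      arcMain N (π / (2 * N)) θ := by
  have hp3 := pi_gt_three
  set y := π / (2 * N) with hy
  have hy0 : 0 < y := by positivity
  have hκ : π * N ≤ ((π : ℂ) ^ 2 / (y + θ * Complex.I)).re := by
    rw [re_sq_pi_div, le_div_iff₀ (by positivity)]
    have h1 : π * N * (2 * y ^ 2) = π ^ 2 * y := by
      rw [hy]; field_simp
    have h2 : θ ^ 2 ≤ y ^ 2 := sq_le_sq.mpr (by rwa [abs_of_pos hy0])
    rw [← h1]
    gcongr
    linarith
  obtain ⟨δ, h1, h2⟩ := overGen_modular (z := y + θ * Complex.I) (by simpa using hy0)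
    (by nlinarith)
  refine ⟨δ, h1.trans (by gcongr), ?_⟩
  have hnC : (N : ℂ) ^ 2 = n := by exact_mod_cast congrArg (fun x : ℝ => (x : ℂ)) hn
  have hsp : (√π : ℂ) ≠ 0 := Complex.ofReal_ne_zero.mpr (sqrt_ne_zero'.mpr pi_pos)
  rw [arcMain, sqrtLine_sq, Complex.exp_add, hnC]
  rw [show ∀ a b c : ℂ, a * b * (1 + c) = a * (1 + c) * b from fun a b c => by ring, h2, sqrtLine]
  field_simp

theorem norm_overGen_mul_sub_arcMain_le {N : ℝ} (hN : 10 ≤ N) {n : ℕ} (hn : N ^ 2 = n) {θ : ℝ}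
    (hθ : |θ| ≤ π / (2 * N)) :
    ‖overGen (Complex.exp (-((π / (2 * N) : ℝ) + θ * Complex.I))) *
        Complex.exp (n * ((π / (2 * N) : ℝ) + θ * Complex.I))‖ ≤ exp (π * N) ∧
    ‖overGen (Complex.exp (-((π / (2 * N) : ℝ) + θ * Complex.I))) *
        Complex.exp (n * ((π / (2 * N) : ℝ) + θ * Complex.I)) - arcMain N (π / (2 * N)) θ‖ ≤
      2 * exp (-(π * N)) := by
  have hp3 := pi_gt_three
  obtain ⟨δ, h1, h2⟩ := arcMain_approx hN hn hθ
  have h3 := norm_arcMain_le hN hθ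
  set G := overGen (Complex.exp (-((π / (2 * N) : ℝ) + θ * Complex.I))) *
        Complex.exp (n * ((π / (2 * N) : ℝ) + θ * Complex.I))
  have hδ : ‖δ‖ ≤ 1 / 2 := by
    refine h1.trans ?_
    have : exp (-(2 * (π * N))) ≤ 1 / 4 := by
      rw [exp_neg, ← one_div]
      refine one_div_le_one_div_of_le (by norm_num) ?_
      have := add_one_le_exp (2 * (π * N))
      nlinarith
    linarith
  have h4 : ‖G‖ ≤ ‖arcMain N (π / (2 * N)) θ‖ + ‖G‖ * ‖δ‖ := by
    rw [← norm_mul, ← h2]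
    have := norm_sub_le (G * (1 + δ)) (G * δ)
    rwa [show G * (1 + δ) - G * δ = G by ring] at this
  have h5 : ‖G‖ ≤ exp (π * N) := by
    nlinarith [norm_nonneg G]
  refine ⟨h5, ?_⟩
  rw [← h2, show G - G * (1 + δ) = -(G * δ) by ring, norm_neg, norm_mul]
  calc ‖G‖ * ‖δ‖ ≤ exp (π * N) * (2 * exp (-(2 * (π * N)))) := by gcongr
    _ = 2 * (exp (π * N) * exp (-(2 * (π * N)))) := by ring
    _ = 2 * exp (-(π * N)) := by rw [← exp_add]; ring_nf

theorem re_one_sub_cexp_inv (y θ : ℝ) :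
    ((1 - Complex.exp (-((y : ℂ) + θ * Complex.I)))⁻¹).re =
      (1 - exp (-y) * cos θ) / ((1 - exp (-y)) ^ 2 + 2 * exp (-y) * (1 - cos θ)) := by
  have hre : (Complex.exp (-((y : ℂ) + θ * Complex.I))).re = exp (-y) * cos θ := by
    rw [Complex.exp_re]; simp
  have him : (Complex.exp (-((y : ℂ) + θ * Complex.I))).im = -(exp (-y) * sin θ) := by
    rw [Complex.exp_im]; simp
  rw [Complex.inv_re, Complex.normSq_apply, Complex.sub_re, Complex.sub_im, hre, him,
    Complex.one_re, Complex.one_im]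
  congr 1
  have := sin_sq_add_cos_sq θ
  linear_combination (exp (-y)) ^ 2 * this

theorem minor_arc_exponent {y : ℝ} (hy0 : 0 < y) (hy : y ≤ 1 / 40) {θ : ℝ} (h1 : y ≤ |θ|)
    (h2 : |θ| ≤ π) :
    97 / 100 / y ≤ 2 * ((1 - exp (-y))⁻¹ -
      ((1 - Complex.exp (-((y : ℂ) + θ * Complex.I)))⁻¹).re) := by
  rw [re_one_sub_cexp_inv]
  set r := exp (-y) with hr
  have hr1 : r < 1 := by rw [hr, exp_lt_one_iff]; linarith
  have hr2 : 1 - y ≤ r := by linarith [add_one_le_exp (-y)]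
  have hcos : cos θ ≤ cos y := by
    rw [← cos_abs θ]
    exact cos_le_cos_of_nonneg_of_le_pi hy0.le h2 h1
  have hc2 := (abs_sub_le_iff.mp (cos_bound (x := y) (by rw [abs_of_pos hy0]; linarith))).1
  rw [abs_of_pos hy0] at hc2
  set d := 1 - cos θ with hd
  have hcd : cos θ = 1 - d := by rw [hd]; ring
  have hd1 : 499 / 1000 * y ^ 2 ≤ d := by
    have : y ^ 4 ≤ (1 / 40) ^ 2 * y ^ 2 := by
      rw [show y ^ 4 = y ^ 2 * y ^ 2 by ring]
      gcongr
    nlinarith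
  have hy2 : 0 < y ^ 2 := by positivity
  have hd0 : 0 < d := by nlinarith
  have hr0 : 39 / 40 ≤ r := by linarith
  have ha : 97 / 100 * y ^ 2 ≤ 2 * r * d := by nlinarith
  have hs0 : 0 < 1 - r := by linarith
  have hs1 : (1 - r) ^ 2 ≤ y ^ 2 := by
    apply pow_le_pow_left₀ hs0.le; linarith
  have key : 2 * ((1 - r)⁻¹ - (1 - r * (1 - d)) / ((1 - r) ^ 2 + 2 * r * d)) =
      (1 + r) / (1 - r) * (2 * r * d / ((1 - r) ^ 2 + 2 * r * d)) := by
    have : (1 - r) ^ 2 + 2 * r * d ≠ 0 := by positivity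
    field_simp
    ring
  rw [hcd, key]
  have e1 : 197 / 100 / y ≤ (1 + r) / (1 - r) := by
    gcongr <;> linarith
  have e2 : 97 / 197 ≤ 2 * r * d / ((1 - r) ^ 2 + 2 * r * d) := by
    rw [le_div_iff₀ (by positivity)]
    linarith
  calc 97 / 100 / y = 197 / 100 / y * (97 / 197) := by ring
    _ ≤ _ := by gcongr

theorem norm_overGen_minor_le {N : ℝ} (hN : 74 ≤ N) {n : ℕ} (hn : N ^ 2 = n) {θ : ℝ}
    (h1 : π / (2 * N) ≤ |θ|) (h2 : |θ| ≤ π) :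
    ‖overGen (Complex.exp (-((π / (2 * N) : ℝ) + θ * Complex.I))) *
        Complex.exp (n * ((π / (2 * N) : ℝ) + θ * Complex.I))‖ ≤ exp (π * N - 3 / 5 * N) := by
  have hp3 := pi_gt_three
  have hp := pi_lt_d2
  have hpos := (norm_overGen_mul_sub_arcMain_le (by linarith : 10 ≤ N) hn (θ := 0)
    (by rw [abs_zero]; positivity)).1
  set y := π / (2 * N) with hy
  have hy0 : 0 < y := by positivity
  have hy1 : y ≤ 1 / 40 := by
    rw [hy, div_le_iff₀ (by positivity)]; linarith
  have hm := minor_arc_exponent hy0 hy1 h1 h2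
  have hq : ‖Complex.exp (-((y : ℂ) + θ * Complex.I))‖ < 1 := by
    rw [norm_cexp_neg_add_mul_I, exp_lt_one_iff]; linarith
  have hb := norm_overGen_le hq
  rw [norm_cexp_neg_add_mul_I] at hb
  have hne : ∀ t : ℝ, ‖Complex.exp (n * ((y : ℂ) + t * Complex.I))‖ = exp (n * y) := by
    intro t
    rw [Complex.norm_exp]
    simp
  rw [norm_mul, hne] at hpos ⊢
  have e0 : Complex.exp (-((y : ℂ) + (0 : ℝ) * Complex.I)) = ((exp (-y) : ℝ) : ℂ) := by
    push_cast; simp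
  rw [e0] at hpos
  have hyN : 3 / 5 * N ≤ 97 / 100 / y := by
    rw [le_div_iff₀ hy0, hy]
    field_simp
    linarith
  calc _ ≤ ‖overGen ((exp (-y) : ℝ) : ℂ)‖ * exp (-(3 / 5 * N)) * exp (n * y) := by
        gcongr
        exact hb.trans (mul_le_mul_of_nonneg_left (exp_le_exp.mpr (by linarith)) (norm_nonneg _))
    _ = ‖overGen ((exp (-y) : ℝ) : ℂ)‖ * exp (n * y) * exp (-(3 / 5 * N)) := by ring
    _ ≤ exp (π * N) * exp (-(3 / 5 * N)) := by gcongr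
    _ = _ := by rw [← exp_add]; ring_nf

theorem le_exp_mul_self {N : ℝ} (hN : 74 ≤ N) : N ≤ exp (3 / 50 * N) := by
  have h1 : exp (3 / 50 * N) = exp 1 ^ 4 * exp (3 / 50 * N - 4) := by
    rw [← exp_nat_mul, ← exp_add]; norm_num
  have h2 := add_one_le_exp (3 / 50 * N - 4)
  have h3 : 54.5 ≤ exp 1 ^ 4 := by
    have h4 : (2.718 : ℝ) ^ 4 ≤ exp 1 ^ 4 := by
      gcongr
      linarith [exp_one_gt_d9]
    refine le_trans ?_ h4
    norm_num
  rw [h1]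
  have h5 : 0 ≤ 3 / 50 * N - 4 + 1 := by linarith
  calc N ≤ 54.5 * (3 / 50 * N - 4 + 1) := by linarith
    _ ≤ _ := by gcongr

theorem pow_ten_le_exp {N : ℝ} (hN : 74 ≤ N) : N ^ 10 ≤ exp (3 / 5 * N) := by
  calc N ^ 10 ≤ exp (3 / 50 * N) ^ 10 := by
        gcongr
        exact le_exp_mul_self hN
    _ = exp (3 / 5 * N) := by
        rw [← exp_nat_mul]
        congr 1
        push_cast
        ring

theorem abs_pbar_sub_le {N : ℝ} (hN : 74 ≤ N) {n : ℕ} (hn : N ^ 2 = n) :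
    |2 * π * N ^ 2 * pbar n - (π / 4 - 1 / (4 * N)) * exp (π * N)| ≤
      8 * N ^ 2 * exp (π * N - 3 / 5 * N) := by
  have hp3 := pi_gt_three
  have hp := pi_lt_d2
  have hN10 : 10 ≤ N := by linarith
  set y := π / (2 * N) with hy
  have hy0 : 0 < y := by positivity
  have hy1 : y ≤ 1 / 40 := by
    rw [hy, div_le_iff₀ (by positivity)]; linarith
  set G : ℝ → ℂ := fun θ => overGen (Complex.exp (-((y : ℂ) + θ * Complex.I))) *
    Complex.exp (n * ((y : ℂ) + θ * Complex.I)) with hG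
  have hGc : Continuous G := (continuous_overGen_circle hy0).mul (by fun_prop)
  have hi : ∀ a b, IntervalIntegrable G volume a b := fun a b => hGc.intervalIntegrable a b
  have htot : (∫ θ in (-π)..(-y), G θ) + (∫ θ in (-y)..y, G θ) + (∫ θ in y..π, G θ) =
      2 * π * pbar n := by
    rw [intervalIntegral.integral_add_adjacent_intervals (hi _ _) (hi _ _),
      intervalIntegral.integral_add_adjacent_intervals (hi _ _) (hi _ _)]
    exact integral_overGen_mul_cexp hy0 n
  have hm1 : ‖∫ θ in (-π)..(-y), G θ‖ ≤ exp (π * N - 3 / 5 * N) * |-y - -π| := by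
    refine intervalIntegral.norm_integral_le_of_norm_le_const fun θ hθ => ?_
    rw [Set.uIoc_of_le (by linarith)] at hθ
    have h1 : |θ| = -θ := abs_of_nonpos (by linarith [hθ.2])
    exact norm_overGen_minor_le hN hn (by rw [h1]; linarith [hθ.2]) (by rw [h1]; linarith [hθ.1])
  have hm2 : ‖∫ θ in y..π, G θ‖ ≤ exp (π * N - 3 / 5 * N) * |π - y| := by
    refine intervalIntegral.norm_integral_le_of_norm_le_const fun θ hθ => ?_
    rw [Set.uIoc_of_le (by linarith)] at hθ
    have h1 : |θ| = θ := abs_of_nonneg (by linarith [hθ.1])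
    exact norm_overGen_minor_le hN hn (by rw [h1]; linarith [hθ.1]) (by rw [h1]; linarith [hθ.2])
  have hcs : Continuous (sqrtLine y) :=
    continuous_iff_continuousAt.mpr fun θ => (hasDerivAt_sqrtLine hy0 θ).continuousAt
  have hne : ∀ θ, 4 * sqrtLine y θ ^ 2 ≠ 0 := fun θ =>
    mul_ne_zero (by norm_num) (pow_ne_zero 2 (sqrtLine_ne_zero hy0 θ))
  have hac : Continuous (arcMain N y) := by
    have := Continuous.div (continuous_const (y := (π : ℂ) ^ 2)) (by fun_prop) hne
    unfold arcMain
    fun_prop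
  have hm3 : ‖(∫ θ in (-y)..y, G θ) - ∫ θ in (-y)..y, arcMain N y θ‖ ≤
      2 * exp (-(π * N)) * |y - -y| := by
    rw [← intervalIntegral.integral_sub (hi _ _) (hac.intervalIntegrable _ _)]
    refine intervalIntegral.norm_integral_le_of_norm_le_const fun θ hθ => ?_
    rw [Set.uIoc_of_le (by linarith)] at hθ
    exact (norm_overGen_mul_sub_arcMain_le hN10 hn (abs_le.mpr ⟨hθ.1.le, hθ.2⟩)).2
  have hm4 := norm_main_arc_sub_le hN10
  rw [← hy] at hm4
  set J := ∫ θ in (-y)..y, sqrtLine y θ *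
    Complex.exp (N ^ 2 * sqrtLine y θ ^ 2 + π ^ 2 / (4 * sqrtLine y θ ^ 2)) with hJ
  have hm5 : ∫ θ in (-y)..y, arcMain N y θ = 1 / (2 * √π) * J := by
    rw [hJ, ← intervalIntegral.integral_const_mul]
    rfl
  rw [hm5] at hm3
  rw [abs_of_nonneg (by linarith)] at hm1 hm2 hm3
  have hsp0 : (√π : ℂ) ≠ 0 := Complex.ofReal_ne_zero.mpr (sqrt_ne_zero'.mpr pi_pos)
  have hNC : (N : ℂ) ≠ 0 := Complex.ofReal_ne_zero.mpr (by linarith)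
  have hid : ((2 * π * N ^ 2 * pbar n - (π / 4 - 1 / (4 * N)) * exp (π * N) : ℝ) : ℂ) =
      N ^ 2 * (∫ θ in (-π)..(-y), G θ) + N ^ 2 * (∫ θ in y..π, G θ) +
      N ^ 2 * ((∫ θ in (-y)..y, G θ) - 1 / (2 * √π) * J) +
      1 / (2 * √π) * (N ^ 2 * J - √π * (π / 2 - 1 / (2 * N)) * Complex.exp (π * N)) := by
    push_cast
    rw [show (2 * π * N ^ 2 * pbar n : ℂ) = N ^ 2 * (2 * π * pbar n) by ring, ← htot]
    field_simp
    ring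
  rw [← Real.norm_eq_abs, ← Complex.norm_real, hid]
  have hsp : 1 ≤ √π := by
    rw [one_le_sqrt]; linarith
  have h3 : ‖(1 / (2 * √π) : ℂ)‖ ≤ 1 / 2 := by
    rw [← Complex.ofReal_ofNat, ← Complex.ofReal_mul, ← Complex.ofReal_one, ← Complex.ofReal_div,
      Complex.norm_real, Real.norm_eq_abs, abs_of_pos (by positivity)]
    exact one_div_le_one_div_of_le (by norm_num) (by linarith)
  have hN2 : ‖(N : ℂ) ^ 2‖ = N ^ 2 := by
    rw [norm_pow, Complex.norm_real, Real.norm_eq_abs, sq_abs]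
  set X := exp (π * N - 3 / 5 * N) with hX
  have hX0 : 0 < X := exp_pos _
  have x1 : exp (-(π * N)) ≤ X := by
    apply exp_le_exp.mpr; nlinarith
  have x2 : exp (3 * π * N / 4) ≤ X := by
    apply exp_le_exp.mpr; nlinarith
  have t1 : ‖(N : ℂ) ^ 2 * (∫ θ in (-π)..(-y), G θ)‖ ≤ N ^ 2 * (X * (-y - -π)) := by
    rw [norm_mul, hN2]; gcongr
  have t2 : ‖(N : ℂ) ^ 2 * (∫ θ in y..π, G θ)‖ ≤ N ^ 2 * (X * (π - y)) := by
    rw [norm_mul, hN2]; gcongr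
  have t3 : ‖(N : ℂ) ^ 2 * ((∫ θ in (-y)..y, G θ) - 1 / (2 * √π) * J)‖ ≤
      N ^ 2 * (2 * X * (y - -y)) := by
    rw [norm_mul, hN2]
    gcongr
    exact hm3.trans (by gcongr; linarith)
  have t4 : ‖(1 / (2 * √π) : ℂ) *
      (N ^ 2 * J - √π * (π / 2 - 1 / (2 * N)) * Complex.exp (π * N))‖ ≤ 1 / 2 * (5 * N * X) := by
    rw [norm_mul]
    gcongr
    exact hm4.trans (by gcongr)
  refine (norm_add_le _ _).trans ((add_le_add (norm_add₃_le.trans (add_le_add (add_le_add t1 t2) t3))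
    t4).trans ?_)
  have u1 : N * X ≤ N ^ 2 * X / 74 := by
    nlinarith [mul_nonneg (by linarith : 0 ≤ N - 74) (by positivity : 0 ≤ N * X)]
  have u2 : N ^ 2 * X * y ≤ N ^ 2 * X * (1 / 40) := by gcongr
  have u3 : N ^ 2 * X * π ≤ N ^ 2 * X * 3.15 := by gcongr
  nlinarith [mul_pos (pow_pos (by linarith : 0 < N) 2) hX0]

/-- `p̄(n)` to relative precision `O(n⁻⁴)`. -/
theorem abs_log_pbar_sub_le {n : ℕ} (hn : 5505 ≤ n) :
    |log (pbar n) - (π * √n - log (8 * n) + log (1 - 1 / (π * √n)))| ≤ 12 / (n : ℝ) ^ 4 := by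
  have hp3 := pi_gt_three
  have hn' : (5505 : ℝ) ≤ n := by exact_mod_cast hn
  set N := √(n : ℝ) with hNd
  have hN2 : N ^ 2 = n := sq_sqrt (by linarith)
  have hN : 74 ≤ N := by
    rw [hNd]
    exact le_sqrt_of_sq_le (by linarith)
  have h := abs_pbar_sub_le hN hN2
  have hinv : 1 / (π * N) ≤ 1 / 200 := by
    apply one_div_le_one_div_of_le (by norm_num); nlinarith
  set a := 1 - 1 / (π * N) with ha
  have ha0 : 199 / 200 ≤ a := by linarith
  set ρ := 8 * N ^ 2 * pbar n * exp (-(π * N)) / a - 1 with hρ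
  have hee : exp (π * N) * exp (-(π * N)) = 1 := by rw [← exp_add]; simp
  have hρ2 : ρ = 4 / (π * a) * exp (-(π * N)) *
      (2 * π * N ^ 2 * pbar n - (π / 4 - 1 / (4 * N)) * exp (π * N)) := by
    have e1 : π / 4 - 1 / (4 * N) = π * a / 4 := by
      rw [ha]; field_simp
    have gen : ∀ {p a Ep En : ℝ} (P : ℝ), p ≠ 0 → a ≠ 0 → Ep * En = 1 → 8 * N ^ 2 * P * En / a - 1 =
        4 / (p * a) * En * (2 * p * N ^ 2 * P - p * a / 4 * Ep) := by
      intro p a Ep En P hp ha h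
      field_simp
      linear_combination a * h
    rw [e1, hρ]
    exact gen _ pi_ne_zero (by linarith) hee
  have hexp : exp (-(3 / 5 * N)) ≤ 1 / N ^ 10 := by
    rw [exp_neg, ← one_div]
    exact one_div_le_one_div_of_le (by positivity) (pow_ten_le_exp hN)
  have hρ3 : |ρ| ≤ 11 / (n : ℝ) ^ 4 := by
    rw [hρ2, abs_mul, abs_of_nonneg (by positivity)]
    calc _ ≤ 4 / (3 * (199 / 200)) * exp (-(π * N)) *
          (8 * N ^ 2 * exp (π * N - 3 / 5 * N)) := by gcongr
      _ = 32 / (3 * (199 / 200)) * N ^ 2 * (exp (-(π * N)) * exp (π * N - 3 / 5 * N)) := by ring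
      _ = 32 / (3 * (199 / 200)) * N ^ 2 * exp (-(3 / 5 * N)) := by
          rw [← exp_add]; ring_nf
      _ ≤ 11 * N ^ 2 * (1 / N ^ 10) := by
          gcongr
          norm_num
      _ = 11 / (n : ℝ) ^ 4 := by
          rw [← hN2]; field_simp
  have hsmall : |ρ| ≤ 1 / 12 := by
    refine hρ3.trans ?_
    rw [div_le_iff₀ (by positivity)]
    have : (5505 : ℝ) ^ 4 ≤ (n : ℝ) ^ 4 := by gcongr
    linarith
  have hρa := abs_le.mp hsmall
  have hP : (pbar n : ℝ) = (1 + ρ) * a * exp (π * N) / (8 * n) := by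
    have gen : ∀ {N a Ep En : ℝ} (P : ℝ), N ≠ 0 → a ≠ 0 → Ep * En = 1 →
        P = (1 + (8 * N ^ 2 * P * En / a - 1)) * a * Ep / (8 * N ^ 2) := by
      intro N a Ep En P hp ha h
      field_simp
      linear_combination (-(8 * P * N ^ 2)) * h
    rw [hρ, ← hN2]
    exact gen _ (by linarith) (by linarith) hee
  have hlog : log (pbar n) = log (1 + ρ) + log a + π * N - log (8 * n) := by
    have h1 : 1 + ρ ≠ 0 := by linarith
    have h2 : a ≠ 0 := by linarith
    have h3 : (8 * n : ℝ) ≠ 0 := by linarith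
    rw [hP, log_div (mul_ne_zero (mul_ne_zero h1 h2) (exp_ne_zero _)) h3,
      log_mul (mul_ne_zero h1 h2) (exp_ne_zero _), log_mul h1 h2, log_exp]
  rw [hlog, show log (1 + ρ) + log a + π * N - log (8 * n) - (π * N - log (8 * n) + log a) =
    log (1 + ρ) by ring]
  have h1 := log_le_sub_one_of_pos (by linarith : 0 < 1 + ρ)
  have h2 := one_sub_inv_le_log_of_pos (by linarith : 0 < 1 + ρ)
  have h3 : 1 - (1 + ρ)⁻¹ = ρ * (1 + ρ)⁻¹ := by
    have : 1 + ρ ≠ 0 := by linarith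
    field_simp
    ring
  have h4 : (1 + ρ)⁻¹ ≤ 12 / 11 := by
    rw [inv_le_comm₀ (by linarith) (by norm_num)]; linarith
  have h5 : 0 < (1 + ρ)⁻¹ := by
    apply inv_pos.mpr; linarith
  have h6 : |log (1 + ρ)| ≤ 12 / 11 * |ρ| := by
    rw [abs_le]
    constructor
    · refine le_trans ?_ h2
      rw [h3]
      nlinarith [neg_abs_le ρ, abs_nonneg ρ]
    · nlinarith [le_abs_self ρ, abs_nonneg ρ]
  calc _ ≤ 12 / 11 * |ρ| := h6
    _ ≤ 12 / 11 * (11 / (n : ℝ) ^ 4) := by gcongr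
    _ = 12 / (n : ℝ) ^ 4 := by ring

theorem nonneg_of_hasDerivAt_nonneg {f f' : ℝ → ℝ} (h0 : 0 ≤ f 0)
    (hf : ∀ t, 0 ≤ t → HasDerivAt f (f' t) t) (hf' : ∀ t, 0 ≤ t → 0 ≤ f' t) {u : ℝ} (hu : 0 ≤ u) :
    0 ≤ f u := by
  have hm : MonotoneOn f (Set.Ici 0) := by
    refine monotoneOn_of_deriv_nonneg (convex_Ici 0)
      (fun t ht => (hf t ht).continuousAt.continuousWithinAt)
      (fun t ht => (hf t (interior_subset ht)).differentiableAt.differentiableWithinAt)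
      fun t ht => ?_
    rw [(hf t (interior_subset ht)).deriv]
    exact hf' t (interior_subset ht)
  exact h0.trans (hm (Set.mem_Ici.mpr le_rfl) hu hu)

/-- The second difference of `f` from `0` with step `h`. -/
def secondDiff (f : ℝ → ℝ) (h : ℝ) : ℝ := f 0 - 2 * f h + f (2 * h)

theorem secondDiff_nonneg {f f' f'' : ℝ → ℝ} (hf : ∀ t, 0 ≤ t → HasDerivAt f (f' t) t)
    (hf' : ∀ t, 0 ≤ t → HasDerivAt f' (f'' t) t) (hf'' : ∀ t, 0 ≤ t → 0 ≤ f'' t)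
    {h : ℝ} (hh : 0 ≤ h) : 0 ≤ secondDiff f h := by
  have hm : ∀ t, 0 ≤ t → f' t ≤ f' (2 * t) := by
    intro t ht
    have h2 : 0 ≤ f' (t + t) - f' t := by
      refine nonneg_of_hasDerivAt_nonneg (f := fun s => f' (t + s) - f' t)
        (f' := fun s => f'' (t + s)) (by simp) (fun s hs => ?_) (fun s hs => hf'' _ (by linarith)) ht
      have := ((hf' (t + s) (by linarith)).comp_const_add t s).sub_const (f' t)
      simpa using this
    rw [two_mul]
    linarith
  refine nonneg_of_hasDerivAt_nonneg (f := secondDiff f) (f' := fun t => 2 * f' (2 * t) - 2 * f' t)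
    (by simp [secondDiff]; linarith) (fun t ht => ?_) (fun t ht => by linarith [hm t ht]) hh
  have h1 := ((hf t ht).const_mul 2).const_sub (f 0)
  have h2 : HasDerivAt (fun s => f (2 * s)) (f' (2 * t) * 2) t := by
    have h3 : HasDerivAt (fun s : ℝ => 2 * s) 2 t := by
      simpa using (hasDerivAt_id t).const_mul (2 : ℝ)
    exact (hf (2 * t) (by linarith)).comp t h3
  refine (h1.add h2).congr_deriv (by ring)

theorem secondDiff_le_of_le_cubic {f f' f'' : ℝ → ℝ} (hf : ∀ t, 0 ≤ t → HasDerivAt f (f' t) t)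
    (hf' : ∀ t, 0 ≤ t → HasDerivAt f' (f'' t) t) {a b c d : ℝ}
    (hf'' : ∀ t, 0 ≤ t → f'' t ≤ a + b * t + c * t ^ 2 + d * t ^ 3) {h : ℝ} (hh : 0 ≤ h) :
    secondDiff f h ≤ a * h ^ 2 + b * h ^ 3 + 7 / 6 * c * h ^ 4 + 3 / 2 * d * h ^ 5 := by
  have hp : ∀ (m : ℕ) (k t : ℝ), HasDerivAt (fun t => k * t ^ (m + 1)) (k * ((m + 1) * t ^ m)) t := by
    intro m k t
    simpa using (hasDerivAt_pow (m + 1) t).const_mul k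
  have key := secondDiff_nonneg
    (f := fun t => a / 2 * t ^ 2 + b / 6 * t ^ 3 + c / 12 * t ^ 4 + d / 20 * t ^ 5 - f t)
    (f' := fun t => a * t ^ 1 + b / 2 * t ^ 2 + c / 3 * t ^ 3 + d / 4 * t ^ 4 - f' t)
    (f'' := fun t => a + b * t + c * t ^ 2 + d * t ^ 3 - f'' t)
    (fun t ht => ((((hp 1 _ t).add (hp 2 _ t)).add (hp 3 _ t)).add (hp 4 _ t) |>.sub
      (hf t ht)).congr_deriv (by push_cast; ring))
    (fun t ht => ((((hp 0 _ t).add (hp 1 _ t)).add (hp 2 _ t)).add (hp 3 _ t) |>.sub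
      (hf' t ht)).congr_deriv (by push_cast; ring))
    (fun t ht => by linarith [hf'' t ht]) hh
  simp only [secondDiff] at key ⊢
  linarith

theorem le_secondDiff_of_cubic_le {f f' f'' : ℝ → ℝ} (hf : ∀ t, 0 ≤ t → HasDerivAt f (f' t) t)
    (hf' : ∀ t, 0 ≤ t → HasDerivAt f' (f'' t) t) {a b c d : ℝ}
    (hf'' : ∀ t, 0 ≤ t → a + b * t + c * t ^ 2 + d * t ^ 3 ≤ f'' t) {h : ℝ} (hh : 0 ≤ h) :
    a * h ^ 2 + b * h ^ 3 + 7 / 6 * c * h ^ 4 + 3 / 2 * d * h ^ 5 ≤ secondDiff f h := by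
  have := secondDiff_le_of_le_cubic (f := fun t => -f t) (f' := fun t => -f' t)
    (f'' := fun t => -f'' t) (a := -a) (b := -b) (c := -c) (d := -d)
    (fun t ht => (hf t ht).neg) (fun t ht => (hf' t ht).neg)
    (fun t ht => by linarith [hf'' t ht]) hh
  simp only [secondDiff] at this ⊢
  linarith

theorem hasDerivAt_one_add_rpow_neg (a : ℝ) {t : ℝ} (ht : 0 ≤ t) :
    HasDerivAt (fun t : ℝ => (1 + t) ^ (-a)) (-(a * (1 + t) ^ (-(a + 1)))) t := by
  have := ((hasDerivAt_id t).const_add 1).rpow_const (p := -a) (Or.inl (by simp; linarith))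
  refine this.congr_deriv ?_
  simp only [id]
  rw [show -(a + 1) = -a - 1 by ring]
  ring

theorem one_add_rpow_neg_le_one {a t : ℝ} (ha : 0 ≤ a) (ht : 0 ≤ t) : (1 + t) ^ (-a) ≤ 1 :=
  rpow_le_one_of_one_le_of_nonpos (by linarith) (by linarith)

theorem one_sub_le_one_add_rpow_neg {a t : ℝ} (ha : 0 ≤ a) (ht : 0 ≤ t) :
    1 - a * t ≤ (1 + t) ^ (-a) := by
  have := nonneg_of_hasDerivAt_nonneg (f := fun t => (1 + t) ^ (-a) - (1 - a * t))
    (f' := fun t => -(a * (1 + t) ^ (-(a + 1))) + a) (by simp) (fun t ht =>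
      ((hasDerivAt_one_add_rpow_neg a ht).sub
        (((hasDerivAt_id t).const_mul a).const_sub 1)).congr_deriv (by ring))
    (fun t ht => by nlinarith [one_add_rpow_neg_le_one (by linarith : 0 ≤ a + 1) ht]) ht
  linarith

theorem one_add_rpow_neg_le_quadratic {a t : ℝ} (ha : 0 ≤ a) (ht : 0 ≤ t) :
    (1 + t) ^ (-a) ≤ 1 - a * t + a * (a + 1) / 2 * t ^ 2 := by
  have := nonneg_of_hasDerivAt_nonneg
    (f := fun t => 1 - a * t + a * (a + 1) / 2 * t ^ 2 - (1 + t) ^ (-a))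
    (f' := fun t => -a + a * (a + 1) * t + (a * (1 + t) ^ (-(a + 1)))) (by simp) (fun t ht =>
      (((((hasDerivAt_id t).const_mul a).const_sub 1).add
        ((hasDerivAt_pow 2 t).const_mul (a * (a + 1) / 2))).sub
          (hasDerivAt_one_add_rpow_neg a ht)).congr_deriv (by push_cast; ring))
    (fun t ht => by
      nlinarith [mul_le_mul_of_nonneg_left
        (one_sub_le_one_add_rpow_neg (by linarith : 0 ≤ a + 1) ht) ha]) ht
  linarith

theorem cubic_le_one_add_rpow_neg {a t : ℝ} (ha : 0 ≤ a) (ht : 0 ≤ t) :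
    1 - a * t + a * (a + 1) / 2 * t ^ 2 - a * (a + 1) * (a + 2) / 6 * t ^ 3 ≤ (1 + t) ^ (-a) := by
  have := nonneg_of_hasDerivAt_nonneg
    (f := fun t => (1 + t) ^ (-a) -
      (1 - a * t + a * (a + 1) / 2 * t ^ 2 - a * (a + 1) * (a + 2) / 6 * t ^ 3))
    (f' := fun t => -(a * (1 + t) ^ (-(a + 1))) -
      (-a + a * (a + 1) * t - a * (a + 1) * (a + 2) / 2 * t ^ 2)) (by simp) (fun t ht =>
      ((hasDerivAt_one_add_rpow_neg a ht).sub (((((hasDerivAt_id t).const_mul a).const_sub 1).add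
        ((hasDerivAt_pow 2 t).const_mul (a * (a + 1) / 2))).sub
        ((hasDerivAt_pow 3 t).const_mul (a * (a + 1) * (a + 2) / 6)))).congr_deriv
          (by push_cast; ring))
    (fun t ht => by
      nlinarith [mul_le_mul_of_nonneg_left
        (one_add_rpow_neg_le_quadratic (by linarith : 0 ≤ a + 1) ht) ha]) ht
  linarith

/-- The second difference of `x ^ (-s)`. -/
noncomputable def rpowDiff (s x : ℝ) : ℝ := x ^ (-s) - 2 * (x + 1) ^ (-s) + (x + 2) ^ (-s)

theorem rpowDiff_eq {s x : ℝ} (hx : 0 < x) :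
    rpowDiff s x = x ^ (-s) * secondDiff (fun t => (1 + t) ^ (-s)) (1 / x) := by
  have h : ∀ c : ℝ, 0 ≤ c → (x + c) ^ (-s) = x ^ (-s) * (1 + c * (1 / x)) ^ (-s) := by
    intro c hc
    rw [← mul_rpow hx.le (by positivity)]
    congr 1
    field_simp
  have h1 := h 1 zero_le_one
  have h2 := h 2 zero_le_two
  rw [one_mul] at h1
  rw [rpowDiff, secondDiff, h1, h2, add_zero, one_rpow]
  ring

theorem hasDerivAt_neg_mul_one_add_rpow_neg (a : ℝ) {t : ℝ} (ht : 0 ≤ t) :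
    HasDerivAt (fun t : ℝ => -(a * (1 + t) ^ (-(a + 1)))) (a * (a + 1) * (1 + t) ^ (-(a + 2))) t := by
  refine (((hasDerivAt_one_add_rpow_neg (a + 1) ht).const_mul a).neg).congr_deriv ?_
  rw [show a + 1 + 1 = a + 2 by ring]
  ring

theorem rpowDiff_nonneg {s x : ℝ} (hs : 0 ≤ s) (hx : 0 < x) : 0 ≤ rpowDiff s x := by
  rw [rpowDiff_eq hx]
  refine mul_nonneg (rpow_nonneg hx.le _) (secondDiff_nonneg
    (fun t ht => hasDerivAt_one_add_rpow_neg s ht)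
    (fun t ht => hasDerivAt_neg_mul_one_add_rpow_neg s ht)
    (fun t ht => by positivity) (by positivity))

theorem rpow_neg_mul_inv_pow {s x : ℝ} (hx : 0 < x) :
    x ^ (-s) * (1 / x) ^ 2 = x ^ (-(s + 2)) := by
  rw [neg_add, rpow_add hx, rpow_neg hx.le 2, rpow_two, one_div, inv_pow]

theorem rpowDiff_le {s x a b c d : ℝ} (hs : 0 ≤ s) (hx : 0 < x)
    (h : ∀ t, 0 ≤ t → (1 + t) ^ (-(s + 2)) ≤ a + b * t + c * t ^ 2 + d * t ^ 3) :
    rpowDiff s x ≤ s * (s + 1) * x ^ (-(s + 2)) *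
      (a + b * (1 / x) + 7 / 6 * c * (1 / x) ^ 2 + 3 / 2 * d * (1 / x) ^ 3) := by
  have := secondDiff_le_of_le_cubic (fun t ht => hasDerivAt_one_add_rpow_neg s ht)
    (fun t ht => hasDerivAt_neg_mul_one_add_rpow_neg s ht)
    (a := s * (s + 1) * a) (b := s * (s + 1) * b) (c := s * (s + 1) * c) (d := s * (s + 1) * d)
    (fun t ht => by
      have := mul_le_mul_of_nonneg_left (h t ht) (by positivity : 0 ≤ s * (s + 1))
      linarith) (by positivity : 0 ≤ 1 / x)
  rw [rpowDiff_eq hx, ← rpow_neg_mul_inv_pow hx]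
  refine (mul_le_mul_of_nonneg_left this (rpow_nonneg hx.le _)).trans (le_of_eq (by ring))

theorem le_rpowDiff {s x a b c d : ℝ} (hs : 0 ≤ s) (hx : 0 < x)
    (h : ∀ t, 0 ≤ t → a + b * t + c * t ^ 2 + d * t ^ 3 ≤ (1 + t) ^ (-(s + 2))) :
    s * (s + 1) * x ^ (-(s + 2)) *
      (a + b * (1 / x) + 7 / 6 * c * (1 / x) ^ 2 + 3 / 2 * d * (1 / x) ^ 3) ≤ rpowDiff s x := by
  have := le_secondDiff_of_cubic_le (fun t ht => hasDerivAt_one_add_rpow_neg s ht)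
    (fun t ht => hasDerivAt_neg_mul_one_add_rpow_neg s ht)
    (a := s * (s + 1) * a) (b := s * (s + 1) * b) (c := s * (s + 1) * c) (d := s * (s + 1) * d)
    (fun t ht => by
      have := mul_le_mul_of_nonneg_left (h t ht) (by positivity : 0 ≤ s * (s + 1))
      linarith) (by positivity : 0 ≤ 1 / x)
  rw [rpowDiff_eq hx, ← rpow_neg_mul_inv_pow hx]
  refine le_trans (le_of_eq (by ring)) (mul_le_mul_of_nonneg_left this (rpow_nonneg hx.le _))

theorem rpowDiff_le_leading {s x : ℝ} (hs : 0 ≤ s) (hx : 0 < x) :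
    rpowDiff s x ≤ s * (s + 1) * x ^ (-(s + 2)) := by
  have := rpowDiff_le (a := 1) (b := 0) (c := 0) (d := 0) hs hx fun t ht => by
    linarith [one_add_rpow_neg_le_one (by linarith : 0 ≤ s + 2) ht]
  linarith

theorem le_rpowDiff_linear {s x : ℝ} (hs : 0 ≤ s) (hx : 0 < x) :
    s * (s + 1) * x ^ (-(s + 2)) * (1 - (s + 2) * (1 / x)) ≤ rpowDiff s x := by
  have := le_rpowDiff (a := 1) (b := -(s + 2)) (c := 0) (d := 0) hs hx fun t ht => by
    linarith [one_sub_le_one_add_rpow_neg (by linarith : 0 ≤ s + 2) ht]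
  refine le_trans (le_of_eq (by ring)) this

theorem rpowDiff_le_quadratic {s x : ℝ} (hs : 0 ≤ s) (hx : 0 < x) :
    rpowDiff s x ≤ s * (s + 1) * x ^ (-(s + 2)) *
      (1 - (s + 2) * (1 / x) + 7 / 12 * ((s + 2) * (s + 3)) * (1 / x) ^ 2) := by
  have := rpowDiff_le (a := 1) (b := -(s + 2)) (c := (s + 2) * (s + 3) / 2) (d := 0) hs hx
    fun t ht => by
      linarith [one_add_rpow_neg_le_quadratic (by linarith : 0 ≤ s + 2) ht]
  refine this.trans (le_of_eq (by ring))

theorem le_rpowDiff_cubic {s x : ℝ} (hs : 0 ≤ s) (hx : 0 < x) :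
    s * (s + 1) * x ^ (-(s + 2)) *
      (1 - (s + 2) * (1 / x) + 7 / 12 * ((s + 2) * (s + 3)) * (1 / x) ^ 2 -
        1 / 4 * ((s + 2) * (s + 3) * (s + 4)) * (1 / x) ^ 3) ≤ rpowDiff s x := by
  have := le_rpowDiff (a := 1) (b := -(s + 2)) (c := (s + 2) * (s + 3) / 2)
    (d := -((s + 2) * (s + 3) * (s + 4) / 6)) hs hx
    fun t ht => by
      linarith [cubic_le_one_add_rpow_neg (by linarith : 0 ≤ s + 2) ht]
  refine le_trans (le_of_eq (by ring)) this

theorem hasDerivAt_log_one_add {t : ℝ} (ht : 0 ≤ t) :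
    HasDerivAt (fun t : ℝ => log (1 + t)) (1 / (1 + t)) t := by
  simpa using ((hasDerivAt_id t).const_add 1).log (by simp; linarith)

theorem sub_sq_half_le_log_one_add {t : ℝ} (ht : 0 ≤ t) : t - t ^ 2 / 2 ≤ log (1 + t) := by
  have := nonneg_of_hasDerivAt_nonneg (f := fun t => log (1 + t) - (t - t ^ 2 / 2))
    (f' := fun t => 1 / (1 + t) - (1 - t)) (by simp) (fun t ht =>
      ((hasDerivAt_log_one_add ht).sub
        ((hasDerivAt_id t).sub ((hasDerivAt_pow 2 t).div_const 2))).congr_deriv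
          (by push_cast; ring))
    (fun t ht => by
      rw [sub_nonneg, le_div_iff₀ (by linarith)]
      nlinarith) ht
  linarith

theorem log_one_add_le_self {t : ℝ} (ht : 0 ≤ t) : log (1 + t) ≤ t := by
  linarith [log_le_sub_one_of_pos (by linarith : 0 < 1 + t)]

/-- The function `log (1 + t) / (1 + t)`. -/
noncomputable def logDiv (t : ℝ) : ℝ := log (1 + t) / (1 + t)

theorem hasDerivAt_logDiv {t : ℝ} (ht : 0 ≤ t) :
    HasDerivAt logDiv ((1 - log (1 + t)) / (1 + t) ^ 2) t := by
  refine ((hasDerivAt_log_one_add ht).div ((hasDerivAt_id t).const_add 1)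
    (by simp; linarith)).congr_deriv ?_
  have : 1 + t ≠ 0 := by linarith
  simp only [id]
  field_simp

theorem hasDerivAt_deriv_logDiv {t : ℝ} (ht : 0 ≤ t) :
    HasDerivAt (fun t : ℝ => (1 - log (1 + t)) / (1 + t) ^ 2)
      ((2 * log (1 + t) - 3) / (1 + t) ^ 3) t := by
  have : 1 + t ≠ 0 := by linarith
  refine (((hasDerivAt_log_one_add ht).const_sub 1).div (((hasDerivAt_id t).const_add 1).pow 2)
    (by simpa using this)).congr_deriv ?_
  simp only [id, Pi.pow_apply]
  field_simp
  push_cast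
  ring

/-- The second difference of `log x / x`. -/
noncomputable def logDivDiff (x : ℝ) : ℝ :=
  log x / x - 2 * (log (x + 1) / (x + 1)) + log (x + 2) / (x + 2)

theorem logDivDiff_eq {x : ℝ} (hx : 0 < x) :
    logDivDiff x = log x * rpowDiff 1 x + 1 / x * secondDiff logDiv (1 / x) := by
  have h : ∀ c : ℝ, 0 ≤ c →
      log (x + c) / (x + c) = log x * (x + c) ^ (-1 : ℝ) + 1 / x * logDiv (c * (1 / x)) := by
    intro c hc
    have h1 : x + c = x * (1 + c * (1 / x)) := by field_simp
    have h2 : 0 < 1 + c * (1 / x) := by positivity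
    rw [rpow_neg_one, logDiv, h1, log_mul hx.ne' h2.ne']
    field_simp
  have h0 := h 0 le_rfl
  have h1 := h 1 zero_le_one
  have h2 := h 2 zero_le_two
  rw [one_mul] at h1
  rw [zero_mul, add_zero] at h0
  rw [logDivDiff, h0, h1, h2, rpowDiff, secondDiff]
  ring

theorem logDivDiff_le {x : ℝ} (hx : 0 < x) :
    logDivDiff x ≤ log x * rpowDiff 1 x + (-3 * (1 / x) ^ 3 + 11 * (1 / x) ^ 4) := by
  have := secondDiff_le_of_le_cubic (fun t ht => hasDerivAt_logDiv ht)
    (fun t ht => hasDerivAt_deriv_logDiv ht) (a := -3) (b := 11) (c := 0) (d := 0)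
    (fun t ht => by
      rw [div_le_iff₀ (by positivity)]
      nlinarith [log_one_add_le_self ht, pow_nonneg ht 2, pow_nonneg ht 3, pow_nonneg ht 4])
    (by positivity : 0 ≤ 1 / x)
  rw [logDivDiff_eq hx]
  nlinarith [mul_le_mul_of_nonneg_left this (by positivity : 0 ≤ 1 / x)]

theorem le_logDivDiff {x : ℝ} (hx : 0 < x) :
    log x * rpowDiff 1 x + (-3 * (1 / x) ^ 3 + 11 * (1 / x) ^ 4 - 175 / 6 * (1 / x) ^ 5) ≤
      logDivDiff x := by
  have := le_secondDiff_of_cubic_le (fun t ht => hasDerivAt_logDiv ht)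
    (fun t ht => hasDerivAt_deriv_logDiv ht) (a := -3) (b := 11) (c := -25) (d := 0)
    (fun t ht => by
      rw [le_div_iff₀ (by positivity)]
      nlinarith [sub_sq_half_le_log_one_add ht, pow_nonneg ht 2, pow_nonneg ht 3,
        pow_nonneg ht 4, pow_nonneg ht 5])
    (by positivity : 0 ≤ 1 / x)
  rw [logDivDiff_eq hx]
  nlinarith [mul_le_mul_of_nonneg_left this (by positivity : 0 ≤ 1 / x)]

theorem sq_rpow_neg_half {N : ℝ} (hN : 0 < N) (k : ℕ) :
    (N ^ 2) ^ (-((k : ℝ) / 2)) = (1 / N) ^ k := by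
  rw [← rpow_natCast N 2, ← rpow_mul hN.le, one_div, inv_pow, ← rpow_natCast N k,
    ← rpow_neg hN.le]
  congr 1
  push_cast
  ring

theorem one_div_sq_pow (N : ℝ) (k : ℕ) : (1 / N ^ 2) ^ k = (1 / N) ^ (2 * k) := by
  rw [← one_div_pow, pow_mul]

theorem rpowDiff_half_le_leading {N : ℝ} (hN : 0 < N) (k : ℕ) :
    rpowDiff (k / 2) (N ^ 2) ≤ k / 2 * (k / 2 + 1) * (1 / N) ^ (k + 4) := by
  have := rpowDiff_le_leading (s := (k : ℝ) / 2) (by positivity) (by positivity : 0 < N ^ 2)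
  rw [show (k : ℝ) / 2 + 2 = ((k + 4 : ℕ) : ℝ) / 2 by push_cast; ring, sq_rpow_neg_half hN] at this
  exact this

theorem le_rpowDiff_half_linear {N : ℝ} (hN : 0 < N) (k : ℕ) :
    k / 2 * (k / 2 + 1) * (1 / N) ^ (k + 4) * (1 - (k / 2 + 2) * (1 / N) ^ 2) ≤
      rpowDiff (k / 2) (N ^ 2) := by
  have := le_rpowDiff_linear (s := (k : ℝ) / 2) (by positivity) (by positivity : 0 < N ^ 2)
  rw [show -((k : ℝ) / 2 + 2) = -(((k + 4 : ℕ) : ℝ) / 2) by push_cast; ring,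
    sq_rpow_neg_half hN, ← one_div_pow] at this
  exact this

theorem rpowDiff_half_le_quadratic {N : ℝ} (hN : 0 < N) (k : ℕ) :
    rpowDiff (k / 2) (N ^ 2) ≤ k / 2 * (k / 2 + 1) * (1 / N) ^ (k + 4) *
      (1 - (k / 2 + 2) * (1 / N) ^ 2 + 7 / 12 * ((k / 2 + 2) * (k / 2 + 3)) * (1 / N) ^ 4) := by
  have := rpowDiff_le_quadratic (s := (k : ℝ) / 2) (by positivity) (by positivity : 0 < N ^ 2)
  rw [show -((k : ℝ) / 2 + 2) = -(((k + 4 : ℕ) : ℝ) / 2) by push_cast; ring,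
    sq_rpow_neg_half hN, one_div_sq_pow, ← one_div_pow] at this
  exact this

theorem le_rpowDiff_half_cubic {N : ℝ} (hN : 0 < N) (k : ℕ) :
    k / 2 * (k / 2 + 1) * (1 / N) ^ (k + 4) *
      (1 - (k / 2 + 2) * (1 / N) ^ 2 + 7 / 12 * ((k / 2 + 2) * (k / 2 + 3)) * (1 / N) ^ 4 -
        1 / 4 * ((k / 2 + 2) * (k / 2 + 3) * (k / 2 + 4)) * (1 / N) ^ 6) ≤
      rpowDiff (k / 2) (N ^ 2) := by
  have := le_rpowDiff_cubic (s := (k : ℝ) / 2) (by positivity) (by positivity : 0 < N ^ 2)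
  rw [show -((k : ℝ) / 2 + 2) = -(((k + 4 : ℕ) : ℝ) / 2) by push_cast; ring,
    sq_rpow_neg_half hN, one_div_sq_pow, one_div_sq_pow, ← one_div_pow] at this
  exact this

/-- The main terms of the asymptotic expansion of `log (rseq α n)`. -/
noncomputable def logRseqMain (α x : ℝ) : ℝ :=
  π * x ^ (-((1 : ℕ) / 2 : ℝ)) - log 8 * x ^ (-((2 : ℕ) / 2 : ℝ)) - (1 + α) * (log x / x) -
    ∑ k ∈ Finset.range 7, 1 / ((k + 1) * π ^ (k + 1)) * x ^ (-((k + 3 : ℕ) / 2 : ℝ))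

theorem abs_log_one_sub_add_sum_le {M : ℝ} (hM : 1 ≤ M) :
    |∑ k ∈ Finset.range 7, 1 / ((k + 1) * π ^ (k + 1)) * (1 / M) ^ (k + 1) +
      log (1 - 1 / (π * M))| ≤ 2 * (1 / M) ^ 8 := by
  have h0 : 0 < 1 / (π * M) := by positivity
  have h1 : 1 / (π * M) ≤ 1 / 2 := by
    gcongr
    nlinarith [pi_gt_three]
  have h2 : 1 / (π * M) ≤ 1 / M := by
    gcongr
    nlinarith [pi_gt_three]
  have h3 := abs_log_sub_add_sum_range_le (x := 1 / (π * M))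
    (by rw [abs_of_pos h0]; linarith) 7
  rw [abs_of_pos h0] at h3
  have h4 : ∑ k ∈ Finset.range 7, 1 / ((k + 1) * π ^ (k + 1)) * (1 / M) ^ (k + 1) =
      ∑ k ∈ Finset.range 7, (1 / (π * M)) ^ (k + 1) / ((k : ℝ) + 1) := by
    refine Finset.sum_congr rfl fun k _ => ?_
    rw [one_div_pow, one_div_pow, mul_pow]
    field_simp
  rw [h4]
  refine h3.trans ?_
  rw [div_le_iff₀ (by linarith)]
  calc (1 / (π * M)) ^ (7 + 1) ≤ (1 / M) ^ 8 := by gcongr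
    _ ≤ 2 * (1 / M) ^ 8 * (1 - 1 / (π * M)) := by
        nlinarith [pow_pos (by positivity : 0 < 1 / M) 8]

theorem pbar_pos (n : ℕ) : 0 < pbar n := by
  refine Finset.sum_pos' (fun _ _ => Nat.zero_le _) ⟨0, by simp, ?_⟩
  refine Nat.mul_pos (Finset.card_pos.mpr ⟨default, ?_⟩) Fintype.card_pos
  simp [Nat.Partition.distincts,
    Subsingleton.elim (default : Nat.Partition 0) (Nat.Partition.indiscrete 0)]

theorem rseq_pos (α : ℝ) {n : ℕ} (hn : 0 < n) : 0 < rseq α n := by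
  have := pbar_pos n
  unfold rseq
  positivity

theorem log_rseq (α : ℝ) {n : ℕ} (hn : 0 < n) :
    log (rseq α n) = (log (pbar n) - α * log n) / n := by
  have h : (0 : ℝ) < n := by exact_mod_cast hn
  have h1 : (0 : ℝ) < pbar n := by exact_mod_cast pbar_pos n
  rw [rseq, log_rpow (by positivity), log_div h1.ne' (by positivity), log_rpow h]
  field_simp

theorem abs_log_rseq_sub_le (α : ℝ) {n : ℕ} (hn : 5505 ≤ n) :
    |log (rseq α n) - logRseqMain α n| ≤ 14 / (n : ℝ) ^ 5 := by
  have hn' : (5505 : ℝ) ≤ n := by exact_mod_cast hn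
  have hn0 : (0 : ℝ) < n := by linarith
  set M := √(n : ℝ) with hM
  have hMM : M ^ 2 = n := sq_sqrt hn0.le
  have hM1 : 1 ≤ M := by nlinarith [sqrt_nonneg (n : ℝ)]
  have hM0 : 0 < M := by linarith
  have h1 := abs_log_pbar_sub_le hn
  rw [← hM] at h1
  have h2 := abs_log_one_sub_add_sum_le hM1
  set S := ∑ k ∈ Finset.range 7, 1 / ((k + 1) * π ^ (k + 1)) * (1 / M) ^ (k + 1) with hS
  have h3 : logRseqMain α n = (π * M - log (8 * n) - S - α * log n) / n := by
    rw [logRseqMain, ← hMM]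
    simp only [sq_rpow_neg_half hM0]
    have h4 : ∑ k ∈ Finset.range 7, 1 / (((k : ℝ) + 1) * π ^ (k + 1)) * (1 / M) ^ (k + 3) =
        S * (1 / M) ^ 2 := by
      rw [hS, Finset.sum_mul]
      refine Finset.sum_congr rfl fun k _ => by ring
    rw [h4, log_mul (by norm_num) (by positivity)]
    field_simp
    ring
  rw [h3, log_rseq α (by omega), ← sub_div, abs_div, abs_of_pos hn0,
    div_le_div_iff₀ hn0 (by positivity)]
  have h5 : 2 * (1 / M) ^ 8 = 2 / (n : ℝ) ^ 4 := by
    rw [← hMM]; field_simp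
  rw [h5] at h2
  have h6 : |log (pbar n) - α * log n - (π * M - log (8 * n) - S - α * log n)| ≤
      14 / (n : ℝ) ^ 4 := by
    have := abs_add_le (log (pbar n) - (π * M - log (8 * n) + log (1 - 1 / (π * M))))
      (S + log (1 - 1 / (π * M)))
    have h7 : 14 / (n : ℝ) ^ 4 = 12 / (n : ℝ) ^ 4 + 2 / (n : ℝ) ^ 4 := by ring
    rw [h7]
    refine le_trans (le_of_eq ?_) (this.trans (add_le_add h1 h2))
    congr 1
    ring
  calc _ ≤ 14 / (n : ℝ) ^ 4 * (n : ℝ) ^ 5 := by gcongr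
    _ = 14 * n := by field_simp

theorem useq_pos (α : ℝ) {n : ℕ} (hn : 0 < n) : 0 < useq α (n + 1) := by
  have h1 := rseq_pos α hn
  have h2 := rseq_pos α (by omega : 0 < n + 1)
  have h3 := rseq_pos α (by omega : 0 < n + 1 + 1)
  unfold useq
  rw [Nat.add_sub_cancel]
  positivity

theorem log_useq (α : ℝ) {n : ℕ} (hn : 0 < n) :
    log (useq α (n + 1)) =
      log (rseq α n) - 2 * log (rseq α (n + 1)) + log (rseq α (n + 2)) := by
  have h1 := rseq_pos α hn
  have h2 := rseq_pos α (by omega : 0 < n + 1)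
  have h3 := rseq_pos α (by omega : 0 < n + 1 + 1)
  rw [useq, Nat.add_sub_cancel, log_div (by positivity) (by positivity),
    log_mul h1.ne' h3.ne', log_pow]
  push_cast
  ring

/-- The second difference of the main terms of `log (rseq α n)`. -/
noncomputable def logRseqMainDiff (α x : ℝ) : ℝ :=
  π * rpowDiff ((1 : ℕ) / 2) x - log 8 * rpowDiff ((2 : ℕ) / 2) x - (1 + α) * logDivDiff x -
    ∑ k ∈ Finset.range 7, 1 / ((k + 1) * π ^ (k + 1)) * rpowDiff ((k + 3 : ℕ) / 2) x

theorem logRseqMain_secondDiff (α x : ℝ) :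
    logRseqMain α x - 2 * logRseqMain α (x + 1) + logRseqMain α (x + 2) =
      logRseqMainDiff α x := by
  simp only [logRseqMain, logRseqMainDiff, rpowDiff, logDivDiff, mul_add, mul_sub,
    Finset.sum_add_distrib, Finset.sum_sub_distrib, Finset.mul_sum]
  have : ∀ y : ℝ,
      ∑ k ∈ Finset.range 7, 1 / (((k : ℝ) + 1) * π ^ (k + 1)) *
        (2 * y ^ (-((k + 3 : ℕ) / 2 : ℝ))) =
      ∑ k ∈ Finset.range 7, 2 * (1 / (((k : ℝ) + 1) * π ^ (k + 1)) *
        y ^ (-((k + 3 : ℕ) / 2 : ℝ))) :=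
    fun y => Finset.sum_congr rfl fun k _ => by ring
  rw [this]
  ring

theorem abs_log_useq_sub_le (α : ℝ) {n : ℕ} (hn : 5505 ≤ n) :
    |log (useq α (n + 1)) - logRseqMainDiff α n| ≤ 56 / (n : ℝ) ^ 5 := by
  have hn0 : (0 : ℝ) < n := by exact_mod_cast (by omega : 0 < n)
  have h0 := abs_log_rseq_sub_le α hn
  have h1 := abs_log_rseq_sub_le α (by omega : 5505 ≤ n + 1)
  have h2 := abs_log_rseq_sub_le α (by omega : 5505 ≤ n + 2)
  have h3 : 14 / ((n + 1 : ℕ) : ℝ) ^ 5 ≤ 14 / (n : ℝ) ^ 5 := by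
    gcongr
    omega
  have h4 : 14 / ((n + 2 : ℕ) : ℝ) ^ 5 ≤ 14 / (n : ℝ) ^ 5 := by
    gcongr
    omega
  have h5 : 56 / (n : ℝ) ^ 5 = 4 * (14 / (n : ℝ) ^ 5) := by ring
  rw [← logRseqMain_secondDiff, log_useq α (by omega), h5]
  push_cast at h0 h1 h2 h3 h4
  rw [abs_le] at h0 h1 h2 ⊢
  constructor <;> linarith

theorem log_eight_bounds : 2 ≤ log 8 ∧ log 8 ≤ 2.1 := by
  have h : log 8 = 3 * log 2 := by
    rw [show (8 : ℝ) = 2 ^ 3 by norm_num, log_pow]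
    norm_num
  rw [h]
  constructor <;> linarith [log_two_gt_d9, log_two_lt_d9]

theorem log_sq_le_self {N : ℝ} (hN : 0 < N) : log (N ^ 2) ≤ N := by
  have h := log_le_sub_one_of_pos (by positivity : 0 < N / 2)
  rw [log_div hN.ne' two_ne_zero] at h
  rw [log_pow]
  push_cast
  linarith [log_two_lt_d9]

/-- The terms up to order `n ^ (-9 / 2)` common to the lower and the upper bound,
with `a = n ^ (-1 / 2)`, `q = 1 / π` and `l = log n`. -/
noncomputable def mainTerms (α a q l : ℝ) : ℝ :=
  3 / 4 * π * a ^ 5 + (3 + 3 * α - 2 * log 8 - 2 * (1 + α) * l) * a ^ 6 -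
    15 / 8 * (2 * q + π) * a ^ 7 +
    (-3 * q ^ 2 - 11 - 11 * α + 6 * log 8 + (6 + 6 * α) * l) * a ^ 8 +
    35 / 192 * (21 * π + 72 * q - 16 * q ^ 3) * a ^ 9

theorem mainTerms_eq {N : ℝ} (hN : 0 < N) {n : ℕ} (hn : N ^ 2 = n) (α : ℝ) :
    1 + 3 * π / (4 * (n : ℝ) ^ ((5 : ℝ) / 2))
    + (3 + 3 * α - 2 * Real.log 8 - 2 * (1 + α) * Real.log n) / (n : ℝ) ^ 3
    - 15 * (2 + π ^ 2) / (8 * π * (n : ℝ) ^ ((7 : ℝ) / 2))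
    + (1 / (π ^ 2 * (n : ℝ) ^ 4)) *
        (-3 - 11 * π ^ 2 - 11 * α * π ^ 2 + 6 * π ^ 2 * Real.log 8
          + (6 + 6 * α) * π ^ 2 * Real.log n)
    + 35 * (21 * π ^ 4 + 72 * π ^ 2 - 16) / (192 * π ^ 3 * (n : ℝ) ^ ((9 : ℝ) / 2)) =
    1 + mainTerms α (1 / N) (1 / π) (log n) := by
  have h : ∀ k : ℕ, (n : ℝ) ^ ((k : ℝ) / 2) = N ^ k := by
    intro k
    rw [← hn, ← rpow_natCast N 2, ← rpow_mul hN.le, ← rpow_natCast N k]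
    congr 1
    push_cast
    ring
  have h5 := h 5
  have h7 := h 7
  have h9 := h 9
  push_cast at h5 h7 h9
  rw [h5, h7, h9, mainTerms]
  set l := log (n : ℝ)
  rw [← hn]
  have := pi_pos
  field_simp
  ring

theorem rpowDiff_half_nonneg {N : ℝ} (hN : 0 < N) (k : ℕ) : 0 ≤ rpowDiff (k / 2) (N ^ 2) :=
  rpowDiff_nonneg (by positivity) (by positivity)

theorem le_logRseqMainDiff {α N : ℝ} (hα : 0 ≤ α) (hN : 1 ≤ N) :
    mainTerms α (1 / N) (1 / π) (log (N ^ 2)) - (120 + 14 * (1 + α) * log (N ^ 2)) * (1 / N) ^ 10 ≤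
      logRseqMainDiff α (N ^ 2) := by
  have hN0 : 0 < N := by linarith
  have hl : 0 ≤ log (N ^ 2) := log_nonneg (by nlinarith)
  set l := log (N ^ 2) with hl'
  have h1 := mul_le_mul_of_nonneg_left (le_rpowDiff_half_cubic hN0 1) pi_pos.le
  have h2 := rpowDiff_half_le_quadratic hN0 2
  have h20 := mul_le_mul_of_nonneg_left h2 (by linarith [log_eight_bounds.1] : 0 ≤ log 8)
  have h21 := mul_le_mul_of_nonneg_left (logDivDiff_le (by positivity : 0 < N ^ 2))
    (by linarith : 0 ≤ 1 + α)
  have h22 := mul_le_mul_of_nonneg_left (mul_le_mul_of_nonneg_left h2 hl)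
    (by linarith : 0 ≤ 1 + α)
  have hq0 : 0 < 1 / π := by positivity
  have hq : 1 / π ≤ 1 / 3 := one_div_le_one_div_of_le (by norm_num) pi_gt_three.le
  have hq' : ∀ k : ℕ, 1 / (((k : ℝ) + 1) * π ^ (k + 1)) = 1 / (k + 1) * (1 / π) ^ (k + 1) := by
    intro k
    rw [one_div_pow]
    field_simp
  have ha0 : 0 < 1 / N := by positivity
  have ha1 : 1 / N ≤ 1 := by rwa [div_le_one hN0]
  rw [← hl'] at h21
  simp only [one_div_sq_pow] at h21
  simp only [logRseqMainDiff, hq', Finset.sum_range_succ, Finset.sum_range_zero, mainTerms]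
  set q := 1 / π
  set a := 1 / N
  have hk : ∀ k m : ℕ, q ^ k * rpowDiff (m / 2) (N ^ 2) ≤
      q ^ k * (m / 2 * (m / 2 + 1) * a ^ (m + 4)) :=
    fun k m => mul_le_mul_of_nonneg_left (rpowDiff_half_le_leading hN0 m) (by positivity)
  have h3 : q * rpowDiff ((3 : ℕ) / 2) (N ^ 2) ≤ q * ((3 : ℕ) / 2 * ((3 : ℕ) / 2 + 1) * a ^ (3 + 4) *
      (1 - ((3 : ℕ) / 2 + 2) * a ^ 2 +
        7 / 12 * (((3 : ℕ) / 2 + 2) * ((3 : ℕ) / 2 + 3)) * a ^ 4)) :=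
    mul_le_mul_of_nonneg_left (rpowDiff_half_le_quadratic hN0 3) hq0.le
  have h4 := hk 2 4
  have h5 := hk 3 5
  have h6 := hk 4 6
  have h7 := hk 5 7
  have h8 := hk 6 8
  have h9 := hk 7 9
  have hs : ∀ k m : ℕ, q ^ k * a ^ (10 + m) ≤ a ^ 10 := by
    intro k m
    rw [pow_add]
    have e1 : q ^ k ≤ 1 := pow_le_one₀ hq0.le (by linarith)
    have e2 : a ^ m ≤ 1 := pow_le_one₀ ha0.le ha1
    have e3 : q ^ k * a ^ m ≤ 1 := mul_le_one₀ e1 (by positivity) e2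
    nlinarith [pow_pos ha0 10]
  have g1 := hs 0 1
  have g2 := hs 1 1
  have g3 := hs 4 0
  have g4 := hs 5 1
  have g5 := hs 6 2
  have g6 := hs 7 3
  have g7 := mul_le_mul_of_nonneg_right pi_lt_four.le (pow_nonneg ha0.le 11)
  have g8 := mul_le_mul_of_nonneg_right log_eight_bounds.2 (pow_nonneg ha0.le 10)
  norm_num at h1 h2 h20 h21 h22 h3 h4 h5 h6 h7 h8 h9 g1 g2 g3 g4 g5 g6 ⊢
  linarith [pow_pos ha0 10]

theorem logRseqMainDiff_le {α N : ℝ} (hα : 0 ≤ α) (hN : 1 ≤ N) :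
    logRseqMainDiff α (N ^ 2) ≤
      mainTerms α (1 / N) (1 / π) (log (N ^ 2)) + (40 + 30 * α) * (1 / N) ^ 10 := by
  have hN0 : 0 < N := by linarith
  have hl : 0 ≤ log (N ^ 2) := log_nonneg (by nlinarith)
  set l := log (N ^ 2) with hl'
  have h1 := mul_le_mul_of_nonneg_left (rpowDiff_half_le_quadratic hN0 1) pi_pos.le
  have h2 := le_rpowDiff_half_linear hN0 2
  have h20 := mul_le_mul_of_nonneg_left h2 (by linarith [log_eight_bounds.1] : 0 ≤ log 8)
  have h21 := mul_le_mul_of_nonneg_left (le_logDivDiff (by positivity : 0 < N ^ 2))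
    (by linarith : 0 ≤ 1 + α)
  have h22 := mul_le_mul_of_nonneg_left (mul_le_mul_of_nonneg_left h2 hl)
    (by linarith : 0 ≤ 1 + α)
  have hq0 : 0 < 1 / π := by positivity
  have hq : 1 / π ≤ 1 / 3 := one_div_le_one_div_of_le (by norm_num) pi_gt_three.le
  have hq' : ∀ k : ℕ, 1 / (((k : ℝ) + 1) * π ^ (k + 1)) = 1 / (k + 1) * (1 / π) ^ (k + 1) := by
    intro k
    rw [one_div_pow]
    field_simp
  have ha0 : 0 < 1 / N := by positivity
  have ha1 : 1 / N ≤ 1 := by rwa [div_le_one hN0]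
  rw [← hl'] at h21
  simp only [one_div_sq_pow] at h21
  simp only [logRseqMainDiff, hq', Finset.sum_range_succ, Finset.sum_range_zero, mainTerms]
  set q := 1 / π
  set a := 1 / N
  have hk : ∀ k m : ℕ, q ^ k * (m / 2 * (m / 2 + 1) * a ^ (m + 4) * (1 - (m / 2 + 2) * a ^ 2)) ≤
      q ^ k * rpowDiff (m / 2) (N ^ 2) :=
    fun k m => mul_le_mul_of_nonneg_left (le_rpowDiff_half_linear hN0 m) (by positivity)
  have hk0 : ∀ k m : ℕ, 0 ≤ q ^ k * rpowDiff (m / 2) (N ^ 2) :=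
    fun k m => mul_nonneg (by positivity) (rpowDiff_half_nonneg hN0 m)
  have h3 := hk 1 3
  have h4 := hk 2 4
  have h5 := hk 3 5
  have h6 := hk0 4 6
  have h7 := hk0 5 7
  have h8 := hk0 6 8
  have h9 := hk0 7 9
  have hs : ∀ k m : ℕ, q ^ k * a ^ (10 + m) ≤ 1 / 3 ^ k * a ^ 10 := by
    intro k m
    rw [pow_add, ← one_div_pow]
    have e1 : q ^ k ≤ (1 / 3) ^ k := by gcongr
    have e2 : a ^ m ≤ 1 := pow_le_one₀ ha0.le ha1
    calc q ^ k * (a ^ 10 * a ^ m) ≤ (1 / 3) ^ k * (a ^ 10 * 1) := by gcongr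
      _ = _ := by ring
  have g1 := hs 2 0
  have g2 := hs 3 1
  norm_num at h1 h2 h20 h21 h22 h3 h4 h5 h6 h7 h8 h9 g1 g2 ⊢
  nlinarith [mul_nonneg hα (pow_nonneg ha0.le 10), pow_nonneg ha0.le 10]

theorem abs_logRseqMainDiff_le {α N : ℝ} (hα : 0 ≤ α) (hN : 8 ≤ N) :
    logRseqMainDiff α (N ^ 2) ≤ 3 * (1 / N) ^ 5 ∧
      -((20 + 20 * α) * (1 / N) ^ 5) ≤ logRseqMainDiff α (N ^ 2) := by
  have hN0 : 0 < N := by linarith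
  have hl : 2 ≤ log (N ^ 2) := log_eight_bounds.1.trans (log_le_log (by norm_num) (by nlinarith))
  have hl1 := log_sq_le_self hN0
  set l := log (N ^ 2) with hl'
  have h1 := mul_le_mul_of_nonneg_left (rpowDiff_half_le_leading hN0 1) pi_pos.le
  have h10 := mul_nonneg pi_pos.le (rpowDiff_half_nonneg hN0 1)
  have h2 := le_rpowDiff_half_linear hN0 2
  have h20 := rpowDiff_half_le_leading hN0 2
  have h21 := le_logDivDiff (by positivity : 0 < N ^ 2)
  have h22 := logDivDiff_le (by positivity : 0 < N ^ 2)
  have hq0 : 0 < 1 / π := by positivity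
  have hq : 1 / π ≤ 1 / 3 := one_div_le_one_div_of_le (by norm_num) pi_gt_three.le
  have hq' : ∀ k : ℕ, 1 / (((k : ℝ) + 1) * π ^ (k + 1)) = 1 / (k + 1) * (1 / π) ^ (k + 1) := by
    intro k
    rw [one_div_pow]
    field_simp
  have ha0 : 0 < 1 / N := by positivity
  have ha1 : 1 / N ≤ 1 / 8 := one_div_le_one_div_of_le (by norm_num) hN
  have hla : l * (1 / N) ≤ 1 := by
    rw [mul_one_div, div_le_one hN0]
    exact hl1
  rw [← hl'] at h21 h22
  simp only [one_div_sq_pow] at h21 h22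
  simp only [logRseqMainDiff, hq', Finset.sum_range_succ, Finset.sum_range_zero]
  set q := 1 / π
  set a := 1 / N
  have hk0 : ∀ k m : ℕ, 0 ≤ q ^ k * rpowDiff (m / 2) (N ^ 2) :=
    fun k m => mul_nonneg (by positivity) (rpowDiff_half_nonneg hN0 m)
  have hk1 : ∀ k m : ℕ, 1 ≤ m → q ^ k * rpowDiff (m / 2) (N ^ 2) ≤
      1 / 3 ^ k * (m / 2 * (m / 2 + 1)) * a ^ 5 := by
    intro k m hm
    have e1 : q ^ k ≤ (1 / 3) ^ k := by gcongr
    have e2 : a ^ (m + 4) ≤ a ^ 5 :=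
      pow_le_pow_of_le_one ha0.le (by linarith) (by omega)
    have e3 := rpowDiff_half_le_leading hN0 m
    have e4 := rpowDiff_half_nonneg hN0 m
    rw [← one_div_pow]
    calc q ^ k * rpowDiff (m / 2) (N ^ 2) ≤
        (1 / 3) ^ k * (m / 2 * (m / 2 + 1) * a ^ (m + 4)) := by gcongr
      _ ≤ (1 / 3) ^ k * (m / 2 * (m / 2 + 1) * a ^ 5) := by gcongr
      _ = _ := by ring
  have hR : 0 ≤ rpowDiff ((2 : ℕ) / 2) (N ^ 2) := rpowDiff_half_nonneg hN0 2
  norm_num at h2 h20 h21 h22 hR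
  have d2 : a ^ 2 ≤ 1 / 64 := by nlinarith
  have d6 : a ^ 6 ≤ 1 / 8 * a ^ 5 := by nlinarith [pow_pos ha0 5]
  have d8 : a ^ 8 ≤ 1 / 64 * a ^ 6 := by nlinarith [pow_pos ha0 6]
  have d10 : a ^ 10 ≤ 1 / 64 * a ^ 8 := by nlinarith [pow_pos ha0 8]
  have h23 : 0 ≤ logDivDiff (N ^ 2) := by
    nlinarith [mul_le_mul_of_nonneg_right hl hR, pow_pos ha0 6, pow_pos ha0 8, pow_pos ha0 10]
  have h24 : logDivDiff (N ^ 2) ≤ 5 * a ^ 5 := by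
    have := mul_le_mul_of_nonneg_left h20 (by linarith : 0 ≤ l)
    nlinarith [mul_le_mul_of_nonneg_right hla (pow_nonneg ha0.le 5), pow_pos ha0 6]
  have h25 := mul_nonneg (by linarith : 0 ≤ 1 + α) h23
  have h26 := mul_le_mul_of_nonneg_left h24 (by linarith : 0 ≤ 1 + α)
  have a3 := hk0 1 3
  have a4 := hk0 2 4
  have a5 := hk0 3 5
  have a6 := hk0 4 6
  have a7 := hk0 5 7
  have a8 := hk0 6 8
  have a9 := hk0 7 9
  have b3 := hk1 1 3 (by norm_num)
  have b4 := hk1 2 4 (by norm_num)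
  have b5 := hk1 3 5 (by norm_num)
  have b6 := hk1 4 6 (by norm_num)
  have b7 := hk1 5 7 (by norm_num)
  have b8 := hk1 6 8 (by norm_num)
  have b9 := hk1 7 9 (by norm_num)
  have b2 := mul_le_mul log_eight_bounds.2 h20 hR (by norm_num)
  have b20 := mul_nonneg (by linarith [log_eight_bounds.1] : 0 ≤ log 8) hR
  have b1 := mul_le_mul_of_nonneg_right pi_lt_d2.le (pow_nonneg ha0.le 5)
  have c5 := mul_nonneg hα (pow_nonneg ha0.le 5)
  have c50 := pow_nonneg ha0.le 5
  norm_num at h1 h10 a3 a4 a5 a6 a7 a8 a9 b3 b4 b5 b6 b7 b8 b9 ⊢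
  constructor
  · linarith
  · linarith

theorem exp_le_quadratic {y : ℝ} (hy : y ≤ 1) : exp y ≤ 1 + y + y ^ 2 := by
  rcases le_or_gt (-1) y with h | h
  · have := (abs_le.mp (abs_exp_sub_one_sub_id_le (abs_le.mpr ⟨h, hy⟩))).2
    linarith
  · have := exp_le_one_iff.mpr (by linarith : y ≤ 0)
    nlinarith

theorem one_add_sq_le_two_rpow {α : ℝ} (hα : 0 ≤ α) :
    2 ^ 31 * (1 + α) ^ 2 ≤ (2 : ℝ) ^ (31 + 18 * α) := by
  have h1 : (2 : ℝ) ^ (31 + 18 * α) = 2 ^ 31 * ((2 : ℝ) ^ (9 * α)) ^ 2 := by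
    rw [rpow_add two_pos, ← rpow_natCast ((2 : ℝ) ^ (9 * α)) 2, ← rpow_mul two_pos.le,
      ← rpow_natCast 2 31]
    congr 2
    push_cast
    ring
  have h2 : 1 + α ≤ (2 : ℝ) ^ (9 * α) := by
    rw [rpow_def_of_pos two_pos]
    nlinarith [add_one_le_exp (log 2 * (9 * α)), log_two_gt_d9]
  rw [h1]
  gcongr

theorem abs_log_useq_sub_logRseqMainDiff_le (α : ℝ) {N : ℝ} (hN : 0 < N) {n : ℕ}
    (hn : N ^ 2 = n) (h : 5505 ≤ n) :
    |log (useq α (n + 1)) - logRseqMainDiff α (N ^ 2)| ≤ 56 * (1 / N) ^ 10 := by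
  have := abs_log_useq_sub_le α h
  rw [← hn] at this
  refine this.trans (le_of_eq ?_)
  field_simp

theorem L1bound_lt_useq {α : ℝ} (hα : 0 ≤ α) {n : ℕ} (hn : 5505 ≤ n) :
    L1bound n α < useq α (n + 1) := by
  have hn' : (5505 : ℝ) ≤ n := by exact_mod_cast hn
  set N := √(n : ℝ) with hN
  have hNn : N ^ 2 = n := sq_sqrt (by linarith)
  have hN1 : 8 ≤ N := by nlinarith [sqrt_nonneg (n : ℝ)]
  have hN0 : 0 < N := by linarith
  have h1 := (abs_le.mp (abs_log_useq_sub_logRseqMainDiff_le α hN0 hNn hn)).1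
  have h2 := le_logRseqMainDiff hα (by linarith : 1 ≤ N)
  have h3 := add_one_le_exp (log (useq α (n + 1)))
  rw [exp_log (useq_pos α (by omega))] at h3
  have h4 : 1 / (n : ℝ) ^ 5 = (1 / N) ^ 10 := by
    rw [← hNn, one_div_pow, ← pow_mul]
  have hl : 0 ≤ log (n : ℝ) := log_nonneg (by linarith)
  rw [L1bound, mainTerms_eq hN0 hNn, h4]
  rw [hNn] at h1 h2
  have h5 : 0 ≤ 105 * (9 * π ^ 2 * (4 + π ^ 2) - 16) / (128 * π ^ 3) := by
    have : 0 ≤ 9 * π ^ 2 * (4 + π ^ 2) - 16 := by nlinarith [pi_gt_three]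
    positivity
  have h6 : 8 * (3 * α + 13) * log n ≤ 8 * (3 * α + (2 : ℝ) ^ (7 * α + 13) + 13) * log n := by
    gcongr
    linarith [rpow_pos_of_pos two_pos (7 * α + 13)]
  have h7 : 120 + 14 * (1 + α) * log n + 56 <
      256 + 105 * (9 * π ^ 2 * (4 + π ^ 2) - 16) / (128 * π ^ 3) +
        8 * (3 * α + (2 : ℝ) ^ (7 * α + 13) + 13) * log n := by
    nlinarith [mul_nonneg hα hl]
  have h8 := mul_lt_mul_of_pos_left h7 (by positivity : 0 < (1 / N) ^ 10)
  linarith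

theorem useq_lt_U1bound {α : ℝ} (hα : 0 ≤ α) {n : ℕ} (hn : 5505 ≤ n) :
    useq α (n + 1) < U1bound n α := by
  have hn' : (5505 : ℝ) ≤ n := by exact_mod_cast hn
  set N := √(n : ℝ) with hN
  have hNn : N ^ 2 = n := sq_sqrt (by linarith)
  have hN1 : 8 ≤ N := by nlinarith [sqrt_nonneg (n : ℝ)]
  have hN0 : 0 < N := by linarith
  have h1 := abs_le.mp (abs_log_useq_sub_logRseqMainDiff_le α hN0 hNn hn)
  have h2 := logRseqMainDiff_le hα (by linarith : 1 ≤ N)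
  obtain ⟨h3, h4⟩ := abs_logRseqMainDiff_le hα hN1
  have h5 : 1 / (n : ℝ) ^ 5 = (1 / N) ^ 10 := by
    rw [← hNn, one_div_pow, ← pow_mul]
  have hl : 0 ≤ log (n : ℝ) := log_nonneg (by linarith)
  have ha : (1 / N) ^ 5 ≤ (1 / 8) ^ 5 := by gcongr
  have ha0 : 0 < (1 / N) ^ 5 := by positivity
  have ha2 : (1 / N) ^ 10 = ((1 / N) ^ 5) ^ 2 := by rw [← pow_mul]
  have ha10 : (1 / N) ^ 10 ≤ (1 / N) ^ 5 := by
    rw [ha2]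
    nlinarith
  have h6 := exp_le_quadratic (y := log (useq α (n + 1))) (by linarith)
  rw [exp_log (useq_pos α (by omega))] at h6
  have h7 : log (useq α (n + 1)) ^ 2 ≤ (80 * (1 + α) * (1 / N) ^ 5) ^ 2 := by
    have := mul_nonneg hα ha0.le
    exact sq_le_sq' (by linarith) (by linarith)
  rw [U1bound, mainTerms_eq hN0 hNn, h5]
  rw [hNn] at h1 h2
  have h8 : 56 + (40 + 30 * α) + 6400 * (1 + α) ^ 2 <
      12 + (2 ^ 12 + 26) * π ^ 2 - 12 * π ^ 2 * log 8 + 32 * α * π ^ 2 +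
        π ^ 2 * (2 : ℝ) ^ (31 + 18 * α) + (2 + 17 * α) * π ^ 2 * log n := by
    have g1 := one_add_sq_le_two_rpow hα
    have hp : 1 ≤ π ^ 2 := by nlinarith [pi_gt_three]
    have g2 : 2 ^ 31 * (1 + α) ^ 2 ≤ π ^ 2 * (2 : ℝ) ^ (31 + 18 * α) :=
      g1.trans (le_mul_of_one_le_left (by positivity) hp)
    have g3 : 0 ≤ (2 + 17 * α) * π ^ 2 * log n := by positivity
    have g4 : 0 ≤ 32 * α * π ^ 2 := by positivity
    have g5 := mul_le_mul_of_nonneg_left log_eight_bounds.2 (by positivity : 0 ≤ 12 * π ^ 2)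
    nlinarith [sq_nonneg α]
  have h9 := mul_lt_mul_of_pos_left h8 (by positivity : 0 < (1 / N) ^ 10)
  have h10 : (80 * (1 + α) * (1 / N) ^ 5) ^ 2 = 6400 * (1 + α) ^ 2 * (1 / N) ^ 10 := by
    rw [ha2]
    ring
  rw [h10] at h7
  linarith [h1.2]

end

theorem stmt15 (α : ℝ) (hα : 0 ≤ α) (n : ℕ) (hn : Ntil α ≤ (n : ℝ)) :
    L1bound n α < useq α (n + 1) ∧ useq α (n + 1) < U1bound n α := by
  have h : (5505 : ℝ) ≤ n :=
    (((le_max_left _ _).trans (le_max_right _ _)).trans (le_max_right _ _)).trans hn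
  have h' : 5505 ≤ n := by exact_mod_cast h
  exact ⟨L1bound_lt_useq hα h', useq_lt_U1bound hα h'⟩
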